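/- There exist points X, Y ∈ ℕ^ℕ such that {X} and {Y} are Π⁰₁ subsets of ℕ^ℕ, X is not Turing reducible to Y^{(ω)}, and Y is not Turing reducible to X^{(ω)}. -/

import Mathlib

namespace Harrington

open scoped Classical

/-- Codes for oracle Turing machines (partial recursive functionals),
    extending `Nat.Partrec.Code` with an `oracle` constructor. -/
inductive OCode : Type
  | zero : OCode
  | succ : OCode
  | left : OCode
  | right : OCode
  | oracle : OCode
  | pair : OCode → OCode → OCode
  | comp : OCode → OCode → OCode
  | prec : OCode → OCode → OCode
  | rfind' : OCode → OCode

/-- Evaluation of an oracle code relative to a (total) oracle `A`. -/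
def evalo (A : ℕ → ℕ) : OCode → ℕ →. ℕ
  | OCode.zero => pure 0
  | OCode.succ => fun n => Part.some (n + 1)
  | OCode.left => fun n => Part.some (Nat.unpair n).1
  | OCode.right => fun n => Part.some (Nat.unpair n).2
  | OCode.oracle => fun n => Part.some (A n)
  | OCode.pair cf cg => fun n => Nat.pair <$> evalo A cf n <*> evalo A cg n
  | OCode.comp cf cg => fun n => evalo A cg n >>= evalo A cf
  | OCode.prec cf cg =>
    Nat.unpaired fun a n =>
      n.rec (evalo A cf a) fun y IH => do
        let i ← IH
        evalo A cg (Nat.pair a (Nat.pair y i))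
  | OCode.rfind' cf =>
    Nat.unpaired fun a m =>
      (Nat.rfind fun n => (fun x => x = 0) <$> evalo A cf (Nat.pair a (n + m))).map (· + m)

/-- The standard enumeration of oracle codes: `OCode.ofNat e` is the `e`-th oracle machine. -/
def OCode.ofNat : ℕ → OCode
  | 0 => OCode.zero
  | 1 => OCode.succ
  | 2 => OCode.left
  | 3 => OCode.right
  | 4 => OCode.oracle
  | n + 5 =>
    have hm : n.div2.div2 < n + 5 := by
      have h1 : n.div2.div2 ≤ n := by
        simp only [Nat.div2_val]
        exact le_trans (Nat.div_le_self _ _) (Nat.div_le_self _ _)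
      omega
    have _m1 : n.div2.div2.unpair.1 < n + 5 := lt_of_le_of_lt (Nat.unpair_left_le _) hm
    have _m2 : n.div2.div2.unpair.2 < n + 5 := lt_of_le_of_lt (Nat.unpair_right_le _) hm
    match n.bodd, n.div2.bodd with
    | false, false => OCode.pair (OCode.ofNat n.div2.div2.unpair.1) (OCode.ofNat n.div2.div2.unpair.2)
    | false, true  => OCode.comp (OCode.ofNat n.div2.div2.unpair.1) (OCode.ofNat n.div2.div2.unpair.2)
    | true,  false => OCode.prec (OCode.ofNat n.div2.div2.unpair.1) (OCode.ofNat n.div2.div2.unpair.2)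
    | true,  true  => OCode.rfind' (OCode.ofNat n.div2.div2)

/-- The Turing jump `A'` of an oracle `A`:  `A'(e) = 1` if the `e`-th machine with
    oracle `A` halts on input `e`, and `A'(e) = 0` otherwise. -/
noncomputable def jump (A : ℕ → ℕ) : ℕ → ℕ :=
  fun e => if (evalo A (OCode.ofNat e) e).Dom then 1 else 0

/-- Iterated Turing jump `A^{(n)}`. -/
noncomputable def jumpIter (A : ℕ → ℕ) : ℕ → (ℕ → ℕ)
  | 0 => A
  | n + 1 => jump (jumpIter A n)

/-- The constant zero function (the trivial oracle `0`). -/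
def zeroF : ℕ → ℕ := fun _ => 0

/-- The `ω`-jump: `X^{(ω)} = {(i,n) : i ∈ X^{(n)}}`, coded via `Nat.pair` and identified
    with its characteristic function. -/
noncomputable def omegaJump (A : ℕ → ℕ) : ℕ → ℕ :=
  fun m => if jumpIter A m.unpair.2 m.unpair.1 ≠ 0 then 1 else 0

/-- The recursive join `A ⊕ B`. -/
def oplus (A B : ℕ → ℕ) : ℕ → ℕ :=
  fun n => if n % 2 = 0 then A (n / 2) else B (n / 2)

/-- Code `c` computes the total function `f` from oracle `A`. -/
def computesFn (A : ℕ → ℕ) (c : OCode) (f : ℕ → ℕ) : Prop :=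
  ∀ n, evalo A c n = Part.some (f n)

/-- Turing reducibility `X ≤_T A` for points of Baire space. -/
def TRedIn (X A : ℕ → ℕ) : Prop := ∃ c : OCode, computesFn A c X

/-- `X` is arithmetical relative to `Y`: `X ≤_T Y^{(n)}` for some `n`. -/
def ArithIn (X Y : ℕ → ℕ) : Prop := ∃ n : ℕ, TRedIn X (jumpIter Y n)

/-- `X` and `Y` are arithmetically equivalent. -/
def ArithEquiv (X Y : ℕ → ℕ) : Prop := ArithIn X Y ∧ ArithIn Y X

/-! ### Strings and trees -/

/-- Strings: finite sequences of natural numbers. -/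
abbrev Str := List ℕ

/-- The initial segment `X↾n` of a point `X` of Baire space. -/
def initSeg (X : ℕ → ℕ) (n : ℕ) : Str := (List.range n).map X

/-- A tree is a set of strings closed under initial segments. -/
def IsTree (T : Set Str) : Prop := ∀ σ τ : Str, σ <+: τ → τ ∈ T → σ ∈ T

/-- `[T]`, the set of paths through `T`. -/
def paths (T : Set Str) : Set (ℕ → ℕ) := {X | ∀ n, initSeg X n ∈ T}

/-- The characteristic function of a set of strings. -/
noncomputable def chi (T : Set Str) : Str → ℕ := fun σ => if σ ∈ T then 1 else 0

/-- A set of strings is `A`-recursive: its characteristic function is computable from `A`. -/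
def SetRecIn (A : ℕ → ℕ) (T : Set Str) : Prop :=
  ∃ c : OCode, ∀ σ : Str, evalo A c (Encodable.encode σ) = Part.some (chi T σ)

/-- `P ⊆ ℕ^ℕ` is `Π^{0,A}_1` : `P = [T]` for some `A`-recursive tree `T`. -/
def IsPi01In (A : ℕ → ℕ) (P : Set (ℕ → ℕ)) : Prop :=
  ∃ T : Set Str, IsTree T ∧ SetRecIn A T ∧ P = paths T

/-- `P ⊆ ℕ^ℕ` is `Π⁰₁` : `P = [T]` for some recursive tree `T`. -/
def IsPi01 (P : Set (ℕ → ℕ)) : Prop := IsPi01In zeroF P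

/-! ### Treemaps -/

/-- `F` is a treemap on the tree `T`: `F(σ⌢⟨i⟩) ⊇ F(σ)⌢⟨i⟩` whenever `σ⌢⟨i⟩ ∈ T`. -/
def IsTreemapOn (T : Set Str) (F : Str → Str) : Prop :=
  ∀ (σ : Str) (i : ℕ), σ ++ [i] ∈ T → (F σ) ++ [i] <+: F (σ ++ [i])

/-- The image tree `F(T) = {τ : ∃ σ ∈ T, τ ⊆ F(σ)}`. -/
def treeImage (F : Str → Str) (T : Set Str) : Set Str :=
  {τ | ∃ σ ∈ T, τ <+: F σ}

/-- The map on paths induced by a treemap: `X ↦ ⋃ₙ F(X↾n)`. -/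
def pathMap (F : Str → Str) (X : ℕ → ℕ) : ℕ → ℕ :=
  fun i => (F (initSeg X (i + 1))).getD i 0

/-- The string function `F` is `A`-recursive on `T` (restriction of a partial
    `A`-recursive function). -/
def FnRecInOn (A : ℕ → ℕ) (F : Str → Str) (T : Set Str) : Prop :=
  ∃ c : OCode, ∀ σ ∈ T, evalo A c (Encodable.encode σ) = Part.some (Encodable.encode (F σ))

/-- `F` maps `P` homeomorphically onto `Q` (subspace topologies from Baire space). -/
def HomeoOn (F : (ℕ → ℕ) → (ℕ → ℕ)) (P Q : Set (ℕ → ℕ)) : Prop :=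
  Set.BijOn F P Q ∧ ContinuousOn F P ∧
    ∃ G : (ℕ → ℕ) → (ℕ → ℕ), Set.InvOn G F P Q ∧ ContinuousOn G Q

/-- `f X ≡_T g X` uniformly for all `X ∈ P`: the Turing reductions are given by
    fixed indices independent of `X`. -/
def UnifEquivOn (P : Set (ℕ → ℕ)) (f g : (ℕ → ℕ) → (ℕ → ℕ)) : Prop :=
  ∃ c d : OCode, ∀ X ∈ P, computesFn (g X) c (f X) ∧ computesFn (f X) d (g X)

/-! ### Standard enumerations -/

/-- `W_e^A`: the `e`-th `A`-recursively enumerable set of strings. -/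
def WA (A : ℕ → ℕ) (e : ℕ) : Set Str :=
  {σ | (evalo A (OCode.ofNat e) (Encodable.encode σ)).Dom}

/-- `T_e^A = {σ : ∀ n ≤ |σ|, σ↾n ∉ W_e^A}`: the standard enumeration of `Π^{0,A}_1` trees. -/
def TA (A : ℕ → ℕ) (e : ℕ) : Set Str :=
  {σ | ∀ n ≤ σ.length, σ.take n ∉ WA A e}

/-- `P_e^A = [T_e^A]`: the standard enumeration of `Π^{0,A}_1` subsets of Baire space. -/
def PA (A : ℕ → ℕ) (e : ℕ) : Set (ℕ → ℕ) := paths (TA A e)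

/-! ### The arithmetical hierarchy on Baire space -/

/-- Prepend a number to a point of Baire space. -/
def consF (k : ℕ) (X : ℕ → ℕ) : ℕ → ℕ := fun i => Nat.casesOn i k fun j => X j

/-- `Σ⁰ₙ` subsets of Baire space.  `Σ⁰₀` sets are the recursive clopen sets
    (depending computably on a fixed finite initial segment), and
    `Σ⁰ₙ₊₁` sets are obtained from `Π⁰ₙ` sets by existential number quantification. -/
def SigmaN : ℕ → Set (ℕ → ℕ) → Prop
  | 0, P => ∃ (k : ℕ) (f : Str → Bool), Computable f ∧ P = {X | f (initSeg X k) = true}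
  | n + 1, P => ∃ Q : Set (ℕ → ℕ), SigmaN n Qᶜ ∧ P = {X | ∃ k : ℕ, consF k X ∈ Q}

/-- `Π⁰ₙ` subsets of Baire space: complements of `Σ⁰ₙ` sets. -/
def PiN (n : ℕ) (P : Set (ℕ → ℕ)) : Prop := SigmaN n Pᶜ

/-- Arithmetical subsets of Baire space: `Π⁰ₙ` for some `n`. -/
def IsArith (P : Set (ℕ → ℕ)) : Prop := ∃ n : ℕ, PiN n P

open Filter
open Nat.Partrec (Code)

/-! ### Compositional rules for primitive recursiveness -/

attribute [fun_prop] Primrec PrimrecPred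
attribute [fun_prop] Primrec.id Primrec.const Primrec.comp PrimrecPred.comp

section PrimrecRules

variable {α β γ δ : Type*} [Primcodable α] [Primcodable β] [Primcodable γ] [Primcodable δ]

@[fun_prop] theorem primrec_fst {f : α → β × γ} (h : Primrec f) : Primrec fun a => (f a).1 :=
  Primrec.fst.comp h

@[fun_prop] theorem primrec_snd {f : α → β × γ} (h : Primrec f) : Primrec fun a => (f a).2 :=
  Primrec.snd.comp h

@[fun_prop] theorem primrec_prodMk {f : α → β} {g : α → γ} (hf : Primrec f) (hg : Primrec g) :
    Primrec fun a => (f a, g a) := hf.pair hg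

@[fun_prop] theorem primrec_encode {f : α → β} (hf : Primrec f) :
    Primrec fun a => Encodable.encode (f a) := Primrec.encode.comp hf

@[fun_prop] theorem primrec_ofNat {β : Type*} [Denumerable β] {f : α → ℕ} (hf : Primrec f) :
    Primrec fun a => Denumerable.ofNat β (f a) := (Primrec.ofNat β).comp hf

@[fun_prop] theorem primrec_some {f : α → β} (hf : Primrec f) :
    Primrec fun a => some (f a) := Primrec.option_some.comp hf

@[fun_prop] theorem primrec_isSome {f : α → Option β} (hf : Primrec f) :
    PrimrecPred fun a => (f a).isSome = true :=
  PrimrecPred.of_eq (p := fun a => (f a).isSome = true)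
    (Primrec.eq.comp (Primrec.option_isSome.comp hf) (Primrec.const true)) fun _ => Iff.rfl

@[fun_prop] theorem primrec_option_bind {f : α → Option β} {g : α → β → Option γ} (hf : Primrec f)
    (hg : Primrec fun p : α × β => g p.1 p.2) : Primrec fun a => (f a).bind fun b => g a b :=
  Primrec.option_bind hf hg

@[fun_prop] theorem primrec_option_elim {f : α → Option β} {d : α → γ} {g : α → β → γ}
    (hf : Primrec f) (hd : Primrec d) (hg : Primrec fun p : α × β => g p.1 p.2) :
    Primrec fun a => (f a).elim (d a) fun b => g a b := by
  refine (Primrec.option_casesOn hf hd (g := g) hg).of_eq fun a => ?_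
  cases f a <;> rfl

@[fun_prop] theorem primrec_add {f g : α → ℕ} (hf : Primrec f) (hg : Primrec g) :
    Primrec fun a => f a + g a := Primrec.nat_add.comp hf hg

@[fun_prop] theorem primrec_sub {f g : α → ℕ} (hf : Primrec f) (hg : Primrec g) :
    Primrec fun a => f a - g a := Primrec.nat_sub.comp hf hg

@[fun_prop] theorem primrec_mul {f g : α → ℕ} (hf : Primrec f) (hg : Primrec g) :
    Primrec fun a => f a * g a := Primrec.nat_mul.comp hf hg

@[fun_prop] theorem primrec_div {f g : α → ℕ} (hf : Primrec f) (hg : Primrec g) :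
    Primrec fun a => f a / g a := Primrec.nat_div.comp hf hg

@[fun_prop] theorem primrec_natPair {f g : α → ℕ} (hf : Primrec f) (hg : Primrec g) :
    Primrec fun a => Nat.pair (f a) (g a) := Primrec₂.natPair.comp hf hg

@[fun_prop] theorem primrec_unpair {f : α → ℕ} (hf : Primrec f) :
    Primrec fun a => Nat.unpair (f a) := Primrec.unpair.comp hf

@[fun_prop] theorem primrec_ite {c : α → Prop} [DecidablePred c] {f g : α → β}
    (hc : PrimrecPred c) (hf : Primrec f) (hg : Primrec g) :
    Primrec fun a => if c a then f a else g a := Primrec.ite hc hf hg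

@[fun_prop] theorem primrecPred_and {p q : α → Prop} (hp : PrimrecPred p) (hq : PrimrecPred q) :
    PrimrecPred fun a => p a ∧ q a := hp.and hq

@[fun_prop] theorem primrecPred_or {p q : α → Prop} (hp : PrimrecPred p) (hq : PrimrecPred q) :
    PrimrecPred fun a => p a ∨ q a := hp.or hq

@[fun_prop] theorem primrecPred_not {p : α → Prop} (hp : PrimrecPred p) :
    PrimrecPred fun a => ¬ p a := hp.not

@[fun_prop] theorem primrecPred_iff {p q : α → Prop} (hp : PrimrecPred p) (hq : PrimrecPred q) :
    PrimrecPred fun a => p a ↔ q a :=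
  ((hp.and hq).or (hp.not.and hq.not)).of_eq fun _ => by tauto

@[fun_prop] theorem primrecPred_eq {f g : α → β} (hf : Primrec f) (hg : Primrec g) :
    PrimrecPred fun a => f a = g a := Primrec.eq.comp hf hg

@[fun_prop] theorem primrecPred_le {f g : α → ℕ} (hf : Primrec f) (hg : Primrec g) :
    PrimrecPred fun a => f a ≤ g a := Primrec.nat_le.comp hf hg

@[fun_prop] theorem primrecPred_lt {f g : α → ℕ} (hf : Primrec f) (hg : Primrec g) :
    PrimrecPred fun a => f a < g a := Primrec.nat_lt.comp hf hg

@[fun_prop] theorem primrec_append {f g : α → List β} (hf : Primrec f) (hg : Primrec g) :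
    Primrec fun a => f a ++ g a := Primrec.list_append.comp hf hg

@[fun_prop] theorem primrec_cons {f : α → β} {g : α → List β} (hf : Primrec f) (hg : Primrec g) :
    Primrec fun a => f a :: g a := Primrec.list_cons.comp hf hg

@[fun_prop] theorem primrec_length {f : α → List β} (hf : Primrec f) :
    Primrec fun a => (f a).length := Primrec.list_length.comp hf

@[fun_prop] theorem primrec_tail {f : α → List β} (hf : Primrec f) :
    Primrec fun a => (f a).tail := Primrec.list_tail.comp hf

@[fun_prop] theorem primrec_headI {f : α → List ℕ} (hf : Primrec f) :
    Primrec fun a => (f a).headI := Primrec.list_headI.comp hf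

@[fun_prop] theorem primrec_take {f : α → ℕ} {g : α → List β} (hf : Primrec f) (hg : Primrec g) :
    Primrec fun a => (g a).take (f a) := Primrec.list_take.comp hf hg

@[fun_prop] theorem primrec_range {f : α → ℕ} (hf : Primrec f) :
    Primrec fun a => List.range (f a) := Primrec.list_range.comp hf

@[fun_prop] theorem primrec_listGetD {f : α → List β} {g : α → ℕ} {d : β} (hf : Primrec f)
    (hg : Primrec g) : Primrec fun a => (f a).getD (g a) d := (Primrec.list_getD d).comp hf hg

@[fun_prop] theorem primrec_getElem? {f : α → List β} {g : α → ℕ} (hf : Primrec f)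
    (hg : Primrec g) : Primrec fun a => (f a)[g a]? := Primrec.list_getElem?.comp hf hg

@[fun_prop] theorem primrec_map {f : α → List β} {g : α → β → γ} (hf : Primrec f)
    (hg : Primrec fun p : α × β => g p.1 p.2) : Primrec fun a => (f a).map fun b => g a b :=
  Primrec.list_map hf hg

@[fun_prop] theorem primrec_foldl {f : α → List β} {g : α → γ} {h : α → γ → β → γ}
    (hf : Primrec f) (hg : Primrec g) (hh : Primrec fun p : α × γ × β => h p.1 p.2.1 p.2.2) :
    Primrec fun a => (f a).foldl (fun s b => h a s b) (g a) :=
  Primrec.list_foldl (h := fun a p => h a p.1 p.2) hf hg hh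

@[fun_prop] theorem primrec_natRec {f : α → ℕ} {g : α → γ} {h : α → ℕ → γ → γ}
    (hf : Primrec f) (hg : Primrec g) (hh : Primrec fun p : α × ℕ × γ => h p.1 p.2.1 p.2.2) :
    Primrec fun a => (Nat.rec (g a) (fun n s => h a n s) (f a) : γ) :=
  Primrec.nat_rec' (h := fun a p => h a p.1 p.2) hf hg hh

@[fun_prop] theorem primrecPred_exists_mem {f : α → List β} {p : α → β → Prop} (hf : Primrec f)
    (hp : PrimrecPred fun x : α × β => p x.1 x.2) : PrimrecPred fun a => ∃ b ∈ f a, p a b := by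
  have h : PrimrecRel fun (b : β) (a : α) => p a b :=
    hp.comp (f := fun x : β × α => (x.2, x.1)) (Primrec.snd.pair Primrec.fst)
  exact h.exists_mem_list.comp hf Primrec.id

@[fun_prop] theorem primrecPred_forall_mem {f : α → List β} {p : α → β → Prop} (hf : Primrec f)
    (hp : PrimrecPred fun x : α × β => p x.1 x.2) : PrimrecPred fun a => ∀ b ∈ f a, p a b := by
  have h : PrimrecRel fun (b : β) (a : α) => p a b :=
    hp.comp (f := fun x : β × α => (x.2, x.1)) (Primrec.snd.pair Primrec.fst)
  exact h.forall_mem_list.comp hf Primrec.id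

@[fun_prop] theorem primrecPred_exists_lt {f : α → ℕ} {p : α → ℕ → Prop} (hf : Primrec f)
    (hp : PrimrecPred fun x : α × ℕ => p x.1 x.2) : PrimrecPred fun a => ∃ k < f a, p a k :=
  (primrecPred_exists_mem (primrec_range hf) hp).of_eq fun a => by simp

@[fun_prop] theorem primrecPred_exists_le {f : α → ℕ} {p : α → ℕ → Prop} (hf : Primrec f)
    (hp : PrimrecPred fun x : α × ℕ => p x.1 x.2) : PrimrecPred fun a => ∃ k ≤ f a, p a k :=
  (primrecPred_exists_lt (primrec_add hf (Primrec.const 1)) hp).of_eq fun a => by simp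

@[fun_prop] theorem primrecPred_forall_lt {f : α → ℕ} {p : α → ℕ → Prop} (hf : Primrec f)
    (hp : PrimrecPred fun x : α × ℕ => p x.1 x.2) : PrimrecPred fun a => ∀ k < f a, p a k :=
  (primrecPred_forall_mem (primrec_range hf) hp).of_eq fun a => by simp

@[fun_prop] theorem primrecPred_forall_le {f : α → ℕ} {p : α → ℕ → Prop} (hf : Primrec f)
    (hp : PrimrecPred fun x : α × ℕ => p x.1 x.2) : PrimrecPred fun a => ∀ k ≤ f a, p a k :=
  (primrecPred_forall_lt (primrec_add hf (Primrec.const 1)) hp).of_eq fun a => by simp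

@[fun_prop] theorem primrecPred_prefix {f g : α → List β} (hf : Primrec f) (hg : Primrec g) :
    PrimrecPred fun a => f a <+: g a :=
  (primrecPred_eq hf (primrec_take (primrec_length hf) hg)).of_eq fun a => by
    rw [List.prefix_iff_eq_take]

@[fun_prop] theorem primrec_evaln {f : α → ℕ} {c : α → Nat.Partrec.Code} {g : α → ℕ}
    (hf : Primrec f) (hc : Primrec c) (hg : Primrec g) :
    Primrec fun a => Nat.Partrec.Code.evaln (f a) (c a) (g a) :=
  Nat.Partrec.Code.primrec_evaln.comp ((hf.pair hc).pair hg)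

end PrimrecRules

/-- The least `k < n` satisfying `p`, if any. -/
noncomputable def leastLt (n : ℕ) (p : ℕ → Prop) : Option ℕ :=
  (List.range n).find? fun k => decide (p k)

theorem leastLt_eq_some {n k : ℕ} {p : ℕ → Prop} :
    leastLt n p = some k ↔ p k ∧ k < n ∧ ∀ j < k, ¬ p j := by
  simp [leastLt, List.find?_range_eq_some]

theorem leastLt_eq_none {n : ℕ} {p : ℕ → Prop} : leastLt n p = none ↔ ∀ j < n, ¬ p j := by
  simp [leastLt]

@[fun_prop] theorem primrec_leastLt {α : Type*} [Primcodable α] {f : α → ℕ} {p : α → ℕ → Prop}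
    (hf : Primrec f) (hp : PrimrecPred fun x : α × ℕ => p x.1 x.2) :
    Primrec fun a => leastLt (f a) (p a) := by
  have h : Primrec fun a => (List.range (f a)).foldl (fun (s : Option ℕ) k =>
      if s.isSome = true then s else if p a k then some k else none) none := by
    fun_prop
  refine h.of_eq fun a => ?_
  have key : ∀ n, (List.range n).foldl (fun (s : Option ℕ) k =>
      if s.isSome = true then s else if p a k then some k else none) none = leastLt n (p a) := by
    intro n
    induction n with
    | zero => rfl
    | succ n ih =>
      rw [List.range_succ, List.foldl_append, ih]
      simp only [leastLt, List.range_succ, List.find?_append, List.foldl_cons, List.foldl_nil]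
      cases hc : (List.range n).find? fun k => decide (p a k) <;> simp [List.find?_cons]
      split_ifs <;> simp_all
  exact key _

/-! ### Initial segments -/

@[simp] theorem initSeg_length (X : ℕ → ℕ) (n : ℕ) : (initSeg X n).length = n := by
  simp [initSeg]

@[simp] theorem initSeg_zero (X : ℕ → ℕ) : initSeg X 0 = [] := rfl

theorem initSeg_succ (X : ℕ → ℕ) (n : ℕ) : initSeg X (n + 1) = initSeg X n ++ [X n] := by
  simp [initSeg, List.range_succ]

theorem initSeg_take (X : ℕ → ℕ) (n k : ℕ) : (initSeg X n).take k = initSeg X (min k n) := by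
  rw [initSeg, ← List.map_take, List.take_range, initSeg]

theorem initSeg_take_of_le (X : ℕ → ℕ) {n k : ℕ} (h : k ≤ n) :
    (initSeg X n).take k = initSeg X k := by
  rw [initSeg_take, min_eq_left h]

theorem initSeg_getElem? (X : ℕ → ℕ) {n i : ℕ} (h : i < n) : (initSeg X n)[i]? = some (X i) := by
  simp [initSeg, h]

theorem initSeg_getElem?_eq_some {X : ℕ → ℕ} {n i v : ℕ} :
    (initSeg X n)[i]? = some v ↔ i < n ∧ X i = v := by
  by_cases h : i < n <;> simp [initSeg, h]

@[simp] theorem initSeg_getElem (X : ℕ → ℕ) (n i : ℕ) (h : i < (initSeg X n).length) :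
    (initSeg X n)[i] = X i := by
  simp [initSeg]

theorem initSeg_getD (X : ℕ → ℕ) {n i : ℕ} (h : i < n) (d : ℕ) : (initSeg X n).getD i d = X i := by
  simp [List.getD_eq_getElem?_getD, initSeg_getElem? X h]

theorem initSeg_prefix (X : ℕ → ℕ) {m n : ℕ} (h : m ≤ n) : initSeg X m <+: initSeg X n := by
  rw [← initSeg_take_of_le X h]
  exact List.take_prefix _ _

theorem initSeg_congr {X Y : ℕ → ℕ} {n : ℕ} (h : ∀ i < n, X i = Y i) :
    initSeg X n = initSeg Y n := by
  apply List.map_congr_left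
  intro i hi
  exact h i (List.mem_range.1 hi)

theorem initSeg_cons (X : ℕ → ℕ) (n : ℕ) :
    initSeg X (n + 1) = X 0 :: initSeg (fun i => X (i + 1)) n := by
  simp only [initSeg, List.range_succ_eq_map, List.map_cons, List.map_map]
  rfl

/-- The string `σ` is an initial segment of the point `X`. -/
def IsInit (σ : List ℕ) (X : ℕ → ℕ) : Prop := σ = initSeg X σ.length

theorem isInit_initSeg (X : ℕ → ℕ) (n : ℕ) : IsInit (initSeg X n) X := by
  simp [IsInit]

theorem IsInit.of_prefix {σ τ : List ℕ} {X : ℕ → ℕ} (h : IsInit τ X) (hp : σ <+: τ) :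
    IsInit σ X := by
  rw [IsInit] at *
  rw [List.prefix_iff_eq_take] at hp
  conv_lhs => rw [hp, h]
  rw [initSeg_take, h]
  congr 1
  have := congrArg List.length hp
  simp at this ⊢
  omega

theorem isInit_iff_prefix {σ : List ℕ} {X : ℕ → ℕ} {n : ℕ} (h : σ.length ≤ n) :
    IsInit σ X ↔ σ <+: initSeg X n := by
  refine ⟨fun hs => ?_, fun hs => (isInit_initSeg X n).of_prefix hs⟩
  rw [hs]
  exact initSeg_prefix X h

theorem IsInit.getD {σ : List ℕ} {X : ℕ → ℕ} (h : IsInit σ X) {i : ℕ} (hi : i < σ.length)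
    (d : ℕ) : σ.getD i d = X i := by
  rw [h, initSeg_getD X hi]

theorem isInit_iff_getElem? {σ : List ℕ} {X : ℕ → ℕ} :
    IsInit σ X ↔ ∀ i < σ.length, σ[i]? = some (X i) := by
  constructor
  · intro h i hi
    rw [h, initSeg_getElem? X hi]
  · intro h
    apply List.ext_getElem (by simp)
    intro i h1 h2
    have := h i h1
    rw [List.getElem?_eq_getElem h1] at this
    simpa using this

theorem IsInit.append_singleton {σ : List ℕ} {X : ℕ → ℕ} {v : ℕ} :
    IsInit (σ ++ [v]) X ↔ IsInit σ X ∧ X σ.length = v := by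
  constructor
  · intro h
    refine ⟨h.of_prefix (List.prefix_append _ _), ?_⟩
    have := h.getD (i := σ.length) (by simp) 0
    simpa using this.symm
  · rintro ⟨h, rfl⟩
    rw [IsInit, List.length_append, List.length_singleton, initSeg_succ, ← h]

/-! ### Oracle codes and ordinary codes -/

/-- Regard an ordinary code as an oracle code which never consults the oracle. -/
def OCode.ofCode : Code → OCode
  | Code.zero => OCode.zero
  | Code.succ => OCode.succ
  | Code.left => OCode.left
  | Code.right => OCode.right
  | Code.pair cf cg => OCode.pair (ofCode cf) (ofCode cg)
  | Code.comp cf cg => OCode.comp (ofCode cf) (ofCode cg)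
  | Code.prec cf cg => OCode.prec (ofCode cf) (ofCode cg)
  | Code.rfind' cf => OCode.rfind' (ofCode cf)

theorem evalo_ofCode (A : ℕ → ℕ) (c : Code) : evalo A (OCode.ofCode c) = c.eval := by
  induction c with
  | zero => rfl
  | succ => rfl
  | left => rfl
  | right => rfl
  | pair cf cg hf hg => simp only [OCode.ofCode, evalo, Code.eval, hf, hg]; rfl
  | comp cf cg hf hg => simp only [OCode.ofCode, evalo, Code.eval, hf, hg]; rfl
  | prec cf cg hf hg => simp only [OCode.ofCode, evalo, Code.eval, hf, hg]; rfl
  | rfind' cf hf => simp only [OCode.ofCode, evalo, Code.eval, hf]; rfl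

/-- Evaluation of an oracle code relative to a partial oracle. -/
def evalp (F : ℕ →. ℕ) : OCode → ℕ →. ℕ
  | OCode.zero => pure 0
  | OCode.succ => fun n => Part.some (n + 1)
  | OCode.left => fun n => Part.some (Nat.unpair n).1
  | OCode.right => fun n => Part.some (Nat.unpair n).2
  | OCode.oracle => F
  | OCode.pair cf cg => fun n => Nat.pair <$> evalp F cf n <*> evalp F cg n
  | OCode.comp cf cg => fun n => evalp F cg n >>= evalp F cf
  | OCode.prec cf cg =>
    Nat.unpaired fun a n =>
      n.rec (evalp F cf a) fun y IH => do
        let i ← IH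
        evalp F cg (Nat.pair a (Nat.pair y i))
  | OCode.rfind' cf =>
    Nat.unpaired fun a m =>
      (Nat.rfind fun n => (fun x => x = 0) <$> evalp F cf (Nat.pair a (n + m))).map (· + m)

theorem evalp_total (f : ℕ → ℕ) (c : OCode) : evalp (fun n => Part.some (f n)) c = evalo f c := by
  induction c with
  | zero => rfl
  | succ => rfl
  | left => rfl
  | right => rfl
  | oracle => rfl
  | pair cf cg hf hg => simp only [evalo, evalp, hf, hg]; rfl
  | comp cf cg hf hg => simp only [evalo, evalp, hf, hg]; rfl
  | prec cf cg hf hg => simp only [evalo, evalp, hf, hg]; rfl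
  | rfind' cf hf => simp only [evalo, evalp, hf]; rfl

theorem evalp_comp (F : ℕ →. ℕ) (cf cg : OCode) (n : ℕ) :
    evalp F (.comp cf cg) n = (evalp F cg n).bind fun a => evalp F cf a := rfl

theorem eval_comp (cf cg : Code) (n : ℕ) :
    (Code.comp cf cg).eval n = (cg.eval n).bind fun a => cf.eval a := rfl

theorem eval_pair (cf cg : Code) (n : ℕ) : (Code.pair cf cg).eval n =
    (cf.eval n).bind fun a => (cg.eval n).map fun b => Nat.pair a b := by
  simp [Code.eval, Seq.seq, Part.bind_map]

theorem eval_left (n : ℕ) : Code.left.eval n = Part.some n.unpair.1 := rfl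

theorem eval_right (n : ℕ) : Code.right.eval n = Part.some n.unpair.2 := rfl

theorem eval_rfind (cf : Code) (a m : ℕ) : (Code.rfind' cf).eval (Nat.pair a m) =
    (Nat.rfind fun n => (cf.eval (Nat.pair a (n + m))).map fun x => decide (x = 0)).map
      (· + m) := by
  simp [Code.eval, Nat.unpaired]

/-- Convergent computations use finitely many oracle values. -/
theorem evalp_eventually {ι : Type*} {l : Filter ι} {F : ℕ →. ℕ} {G : ι → ℕ →. ℕ}
    (h : ∀ x y, y ∈ F x → ∀ᶠ k in l, y ∈ G k x) (c : OCode) :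
    ∀ x y, y ∈ evalp F c x → ∀ᶠ k in l, y ∈ evalp (G k) c x := by
  induction c with
  | zero => exact fun x y hy => Filter.Eventually.of_forall fun _ => hy
  | succ => exact fun x y hy => Filter.Eventually.of_forall fun _ => hy
  | left => exact fun x y hy => Filter.Eventually.of_forall fun _ => hy
  | right => exact fun x y hy => Filter.Eventually.of_forall fun _ => hy
  | oracle => exact h
  | pair cf cg hf hg =>
    intro x y hy
    simp only [evalp, Seq.seq, Part.map_eq_map, Part.mem_bind_iff, Part.mem_map_iff] at hy ⊢
    obtain ⟨p, ⟨a, ha, rfl⟩, b, hb, rfl⟩ := hy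
    filter_upwards [hf x a ha, hg x b hb] with k h1 h2
    exact ⟨_, ⟨a, h1, rfl⟩, b, h2, rfl⟩
  | comp cf cg hf hg =>
    intro x y hy
    simp only [evalp_comp, Part.mem_bind_iff] at hy ⊢
    obtain ⟨a, ha, hb⟩ := hy
    filter_upwards [hg x a ha, hf a y hb] with k h1 h2
    exact ⟨a, h1, h2⟩
  | prec cf cg hf hg =>
    intro x
    simp only [evalp, Nat.unpaired, Part.bind_eq_bind]
    generalize (Nat.unpair x).1 = a
    induction (Nat.unpair x).2 with
    | zero => exact fun y hy => hf a y hy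
    | succ n ih =>
      intro y hy
      simp only [Part.mem_bind_iff] at hy ⊢
      obtain ⟨i, hi, hy⟩ := hy
      filter_upwards [ih i hi, hg _ y hy] with k h1 h2
      exact ⟨i, h1, h2⟩
  | rfind' cf hf =>
    intro x y hy
    simp only [evalp, Nat.unpaired, Part.mem_map_iff] at hy ⊢
    obtain ⟨n, hy, rfl⟩ := hy
    obtain ⟨hy, hn⟩ := Nat.mem_rfind.1 hy
    obtain ⟨b, hb, hb0⟩ := (Part.mem_map_iff _).1 hy
    have hlt : ∀ᶠ k in l, ∀ m ∈ Set.Iio n, ∃ a ∈ evalp (G k) cf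
        (Nat.pair (Nat.unpair x).1 (m + (Nat.unpair x).2)), decide (a = 0) = false := by
      rw [Filter.eventually_all_finite (Set.finite_Iio n)]
      intro m hm
      obtain ⟨a, ha, ha0⟩ := (Part.mem_map_iff _).1 (hn hm)
      filter_upwards [hf _ a ha] with k h1
      exact ⟨a, h1, ha0⟩
    filter_upwards [hf _ b hb, hlt] with k h1 h2
    exact ⟨n, Nat.mem_rfind.2 ⟨(Part.mem_map_iff _).2 ⟨b, h1, hb0⟩,
      fun {m} hm => (Part.mem_map_iff _).2 (h2 m hm)⟩, rfl⟩

/-- The partial function given by a coded finite string. -/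
def strFn (u : ℕ) : ℕ →. ℕ := fun x => ((Denumerable.ofNat (List ℕ) u)[x]? : Option ℕ)

theorem exists_lookup_code : ∃ c : Code, ∀ u x, c.eval (Nat.pair u x) = strFn u x := by
  have h : Primrec fun n : ℕ => (Denumerable.ofNat (List ℕ) n.unpair.1)[n.unpair.2]? := by fun_prop
  have h2 : Nat.Partrec fun n : ℕ =>
      ((Denumerable.ofNat (List ℕ) n.unpair.1)[n.unpair.2]? : Option ℕ) :=
    Partrec.nat_iff.1 (Computable.ofOption h.to_comp)
  obtain ⟨c, hc⟩ := Code.exists_code.1 h2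
  refine ⟨c, fun u x => ?_⟩
  rw [hc]
  simp [strFn]

/-- A code looking up entries of a coded string. -/
noncomputable def lookupCode : Code := exists_lookup_code.choose

theorem eval_lookupCode (u x : ℕ) : lookupCode.eval (Nat.pair u x) = strFn u x :=
  exists_lookup_code.choose_spec u x

/-- Code for `⟨u, ⟨a, n⟩⟩ ↦ ⟨⟨u, a⟩, n⟩`. -/
def assocCode : Code := .pair (.pair .left (.comp .left .right)) (.comp .right .right)

/-- Code for `⟨⟨u, a⟩, n⟩ ↦ ⟨u, ⟨a, n⟩⟩`. -/
def unassocCode : Code := .pair (.comp .left .left) (.pair (.comp .right .left) .right)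

theorem eval_assocCode (u a n : ℕ) :
    assocCode.eval (Nat.pair u (Nat.pair a n)) = Part.some (Nat.pair (Nat.pair u a) n) := by
  simp [assocCode, eval_comp, eval_pair, eval_left, eval_right]

theorem eval_unassocCode (u a n : ℕ) :
    unassocCode.eval (Nat.pair (Nat.pair u a) n) = Part.some (Nat.pair u (Nat.pair a n)) := by
  simp [unassocCode, eval_comp, eval_pair, eval_left, eval_right]

/-- Translate oracle codes into codes taking a finite oracle as an extra argument. -/
noncomputable def OCode.toCode : OCode → Code
  | zero => Code.zero
  | succ => .comp .succ .right
  | left => .comp .left .right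
  | right => .comp .right .right
  | oracle => lookupCode
  | pair cf cg => .pair cf.toCode cg.toCode
  | comp cf cg => .comp cf.toCode (.pair .left cg.toCode)
  | prec cf cg => .comp (.prec cf.toCode (.comp cg.toCode unassocCode)) assocCode
  | rfind' cf => .comp (.rfind' (.comp cf.toCode unassocCode)) assocCode

theorem eval_toCode (c : OCode) :
    ∀ u x, c.toCode.eval (Nat.pair u x) = evalp (strFn u) c x := by
  induction c with
  | zero => intro u x; rfl
  | succ => intro u x; simp [OCode.toCode, eval_comp, Code.eval, evalp]
  | left => intro u x; simp [OCode.toCode, eval_comp, Code.eval, evalp]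
  | right => intro u x; simp [OCode.toCode, eval_comp, Code.eval, evalp]
  | oracle => intro u x; simp [OCode.toCode, eval_lookupCode, evalp]
  | pair cf cg hf hg => intro u x; simp [OCode.toCode, Code.eval, evalp, hf, hg]
  | comp cf cg hf hg =>
    intro u x
    simp [OCode.toCode, eval_comp, evalp_comp, Code.eval, hg, Seq.seq, Part.bind_map, hf]
  | prec cf cg hf hg =>
    intro u x
    obtain ⟨a, n, rfl⟩ : ∃ a n, x = Nat.pair a n := ⟨x.unpair.1, x.unpair.2, by simp⟩
    simp only [OCode.toCode, eval_comp, eval_assocCode, Part.bind_some]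
    simp only [Code.eval, evalp, Nat.unpaired, Nat.unpair_pair, Part.bind_eq_bind]
    induction n with
    | zero => exact hf u a
    | succ n ih =>
      simp only [ih]
      congr 1
      funext i
      change (Code.comp cg.toCode unassocCode).eval _ = _
      rw [eval_comp, eval_unassocCode, Part.bind_some, hg]
  | rfind' cf hf =>
    intro u x
    obtain ⟨a, n, rfl⟩ : ∃ a n, x = Nat.pair a n := ⟨x.unpair.1, x.unpair.2, by simp⟩
    simp only [OCode.toCode, eval_comp, eval_assocCode, Part.bind_some]
    simp [eval_rfind, evalp, Nat.unpaired, eval_comp, eval_unassocCode, hf]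

theorem mem_evalo_of_string {f : ℕ → ℕ} {c : OCode} {k x y : ℕ}
    (h : y ∈ c.toCode.eval (Nat.pair (Encodable.encode (initSeg f k)) x)) : y ∈ evalo f c x := by
  rw [eval_toCode] at h
  rw [← evalp_total]
  have := evalp_eventually (l := pure ()) (G := fun _ n => Part.some (f n)) ?_ c x y h
  · simpa using this
  · intro x y hy
    simp only [strFn, Denumerable.ofNat_encode, Part.mem_coe, Option.mem_def,
      initSeg_getElem?_eq_some] at hy
    simp [hy.2]

theorem mem_evalo_iff {f : ℕ → ℕ} {c : OCode} {x y : ℕ} :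
    y ∈ evalo f c x ↔ ∃ K, ∃ j ≤ K,
      Code.evaln K c.toCode (Nat.pair (Encodable.encode (initSeg f j)) x) = some y := by
  constructor
  · intro h
    rw [← evalp_total] at h
    have := evalp_eventually (l := Filter.atTop)
      (G := fun k => strFn (Encodable.encode (initSeg f k))) ?_ c x y h
    · obtain ⟨j, hj⟩ := this.exists
      rw [← eval_toCode] at hj
      obtain ⟨k, hk⟩ := Code.evaln_complete.1 hj
      exact ⟨max j k, j, le_max_left _ _, Code.evaln_mono (le_max_right _ _) hk⟩
    · intro x y hy
      simp only [Part.mem_some_iff] at hy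
      filter_upwards [Filter.eventually_gt_atTop x] with k hk
      simp [strFn, initSeg_getElem? f hk, hy]
  · rintro ⟨K, j, -, h⟩
    exact mem_evalo_of_string (Code.evaln_sound h)

section CodeRules

variable {α : Type*} [Primcodable α]

@[fun_prop] theorem primrec_codePair {f g : α → Code} (hf : Primrec f) (hg : Primrec g) :
    Primrec fun a => Code.pair (f a) (g a) := Code.primrec₂_pair.comp hf hg

@[fun_prop] theorem primrec_codeComp {f g : α → Code} (hf : Primrec f) (hg : Primrec g) :
    Primrec fun a => Code.comp (f a) (g a) := Code.primrec₂_comp.comp hf hg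

@[fun_prop] theorem primrec_codePrec {f g : α → Code} (hf : Primrec f) (hg : Primrec g) :
    Primrec fun a => Code.prec (f a) (g a) := Code.primrec₂_prec.comp hf hg

@[fun_prop] theorem primrec_codeRfind {f : α → Code} (hf : Primrec f) :
    Primrec fun a => Code.rfind' (f a) := Code.primrec_rfind'.comp hf

@[fun_prop] theorem primrec_div2 {f : α → ℕ} (hf : Primrec f) :
    Primrec fun a => Nat.div2 (f a) := Primrec.nat_div2.comp hf

@[fun_prop] theorem primrec_bodd {f : α → ℕ} (hf : Primrec f) :
    Primrec fun a => Nat.bodd (f a) := Primrec.nat_bodd.comp hf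

end CodeRules

theorem primrec_toCode_ofNat : Primrec fun e : ℕ => (OCode.ofNat e).toCode := by
  have hg : Primrec fun L : List Code =>
      if L.length < 5 then
        some ([OCode.zero.toCode, OCode.succ.toCode, OCode.left.toCode, OCode.right.toCode,
          OCode.oracle.toCode].getD L.length Code.zero)
      else (L[(L.length - 5).div2.div2.unpair.1]?).bind fun s =>
        (L[(L.length - 5).div2.div2.unpair.2]?).bind fun t =>
          (L[(L.length - 5).div2.div2]?).bind fun r =>
            some (if (L.length - 5).bodd = true then
              if (L.length - 5).div2.bodd = true then
                .comp (.rfind' (.comp r unassocCode)) assocCode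
              else .comp (.prec s (.comp t unassocCode)) assocCode
            else if (L.length - 5).div2.bodd = true then .comp s (.pair .left t)
              else .pair s t) := by
    fun_prop
  have := Primrec.nat_strong_rec (α := Unit) (fun _ e => (OCode.ofNat e).toCode)
    (hg.comp Primrec.snd).to₂ ?_
  · exact this.comp (Primrec.const ()) Primrec.id
  · intro _ n
    match n with
    | 0 => simp [OCode.ofNat]
    | 1 => simp [OCode.ofNat]
    | 2 => simp [OCode.ofNat]
    | 3 => simp [OCode.ofNat]
    | 4 => simp [OCode.ofNat]
    | n + 5 =>
      have hm : n.div2.div2 < n + 5 := by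
        simp only [Nat.div2_val]
        omega
      have h1 : n.div2.div2.unpair.1 < n + 5 := lt_of_le_of_lt (Nat.unpair_left_le _) hm
      have h2 : n.div2.div2.unpair.2 < n + 5 := lt_of_le_of_lt (Nat.unpair_right_le _) hm
      rw [OCode.ofNat]
      rcases hb : n.bodd <;> rcases hb2 : n.div2.bodd <;>
        simp [hm, h1, h2, hb, hb2, OCode.toCode]

/-! ### A universal `Σ₁` predicate of two oracles -/

/-- The string coded by a number. -/
def strOf (k : ℕ) : List ℕ := Denumerable.ofNat (List ℕ) k

@[simp] theorem strOf_encode (u : List ℕ) : strOf (Encodable.encode u) = u :=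
  Denumerable.ofNat_encode u

@[fun_prop] theorem primrec_strOf {α : Type*} [Primcodable α] {f : α → ℕ} (hf : Primrec f) :
    Primrec fun a => strOf (f a) := primrec_ofNat hf

/-- The `m`-th `Σ₁` question has been answered positively by the finite oracles `τ` and `α`. -/
def Sm (m : ℕ) (τ α : List ℕ) : Prop :=
  ∃ k ≤ τ.length, k ≤ α.length ∧ (Code.evaln α.length (Denumerable.ofNat Code m.unpair.1)
    (Nat.pair m.unpair.2 (Nat.pair (Encodable.encode (τ.take k))
      (Encodable.encode (α.take k))))).isSome = true

section
variable {α : Type*} [Primcodable α]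

@[fun_prop] theorem primrecPred_Sm {m : α → ℕ} {s t : α → List ℕ} (hm : Primrec m)
    (hs : Primrec s) (ht : Primrec t) : PrimrecPred fun a => Sm (m a) (s a) (t a) := by
  unfold Sm
  fun_prop

end

theorem take_eq_of_prefix {σ τ : List ℕ} (h : σ <+: τ) {k : ℕ} (hk : k ≤ σ.length) :
    τ.take k = σ.take k := by
  obtain ⟨ρ, rfl⟩ := h
  rw [List.take_append_of_le_length hk]

theorem Sm.mono {m : ℕ} {τ τ' α α' : List ℕ} (h : Sm m τ α) (hτ : τ <+: τ') (hα : α <+: α') :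
    Sm m τ' α' := by
  obtain ⟨k, h1, h2, h3⟩ := h
  refine ⟨k, h1.trans hτ.length_le, h2.trans hα.length_le, ?_⟩
  rw [take_eq_of_prefix hτ h1, take_eq_of_prefix hα h2]
  obtain ⟨v, hv⟩ := Option.isSome_iff_exists.1 h3
  rw [Code.evaln_mono hα.length_le hv]
  rfl

/-- The `m`-th `Σ₁` question has a positive answer relative to `Y` and `O`. -/
def J2 (m : ℕ) (Y O : ℕ → ℕ) : Prop := ∃ K, Sm m (initSeg Y K) (initSeg O K)

theorem Sm.j2 {m : ℕ} {τ α : List ℕ} {Y O : ℕ → ℕ} (h : Sm m τ α) (hτ : IsInit τ Y)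
    (hα : IsInit α O) : J2 m Y O :=
  ⟨max τ.length α.length, h.mono ((isInit_iff_prefix (le_max_left _ _)).1 hτ)
    ((isInit_iff_prefix (le_max_right _ _)).1 hα)⟩

theorem J2.eventually {m : ℕ} {Y O : ℕ → ℕ} (h : J2 m Y O) :
    ∀ᶠ K in atTop, Sm m (initSeg Y K) (initSeg O K) := by
  obtain ⟨K, hK⟩ := h
  filter_upwards [eventually_ge_atTop K] with L hL
  exact hK.mono (initSeg_prefix _ hL) (initSeg_prefix _ hL)

theorem exists_universal_index {M : ℕ → List ℕ → List ℕ → Prop}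
    (hM : PrimrecPred fun x : ℕ × List ℕ × List ℕ => M x.1 x.2.1 x.2.2) :
    ∃ p, ∀ y Y O, J2 (Nat.pair p y) Y O ↔ ∃ K, M y (initSeg Y K) (initSeg O K) := by
  have h1 : Primrec fun n : ℕ => if M n.unpair.1 (strOf n.unpair.2.unpair.1)
      (strOf n.unpair.2.unpair.2) then some 0 else none := by
    have : PrimrecPred fun n : ℕ => M n.unpair.1 (strOf n.unpair.2.unpair.1)
      (strOf n.unpair.2.unpair.2) := hM.comp (f := fun n : ℕ => (n.unpair.1,
        strOf n.unpair.2.unpair.1, strOf n.unpair.2.unpair.2)) (by fun_prop)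
    fun_prop
  have h2 : Nat.Partrec fun n : ℕ => ((if M n.unpair.1 (strOf n.unpair.2.unpair.1)
      (strOf n.unpair.2.unpair.2) then some 0 else none : Option ℕ) : Part ℕ) :=
    Partrec.nat_iff.1 (Computable.ofOption h1.to_comp)
  obtain ⟨c, hc⟩ := Code.exists_code.1 h2
  have key : ∀ y u w, (c.eval (Nat.pair y (Nat.pair (Encodable.encode u)
      (Encodable.encode w)))).Dom ↔ M y u w := by
    intro y u w
    rw [hc]
    simp only [Nat.unpair_pair, strOf_encode]
    split_ifs with h <;> simp [h]
  refine ⟨Encodable.encode c, fun y Y O => ?_⟩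
  constructor
  · rintro ⟨K, k, h1, h2, h3⟩
    simp only [initSeg_length] at h1
    rw [initSeg_take_of_le _ h1, initSeg_take_of_le _ h1] at h3
    obtain ⟨v, hv⟩ := Option.isSome_iff_exists.1 h3
    have hd := Part.dom_iff_mem.2 ⟨v, Code.evaln_sound hv⟩
    simp only [Nat.unpair_pair, Denumerable.ofNat_encode] at hd
    exact ⟨k, (key _ _ _).1 hd⟩
  · rintro ⟨k, hk⟩
    obtain ⟨v, hv⟩ := Part.dom_iff_mem.1 ((key _ _ _).2 hk)
    obtain ⟨n, hn⟩ := Code.evaln_complete.1 hv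
    refine ⟨max k n, k, by simp, by simp, ?_⟩
    rw [initSeg_take_of_le _ (le_max_left _ _), initSeg_take_of_le _ (le_max_left _ _)]
    simp only [Nat.unpair_pair, Denumerable.ofNat_encode, initSeg_length]
    rw [Code.evaln_mono (le_max_right _ _) hn]
    rfl

/-! ### Graph reducibility -/

/-- The question with index `i` and argument `y`. -/
def ask (i y : ℕ) : ℕ := Nat.pair i.unpair.1 (Nat.pair i.unpair.2 y)

theorem ask_pair (p a y : ℕ) : ask (Nat.pair p a) y = Nat.pair p (Nat.pair a y) := by
  simp [ask]

@[fun_prop] theorem primrec_ask {α : Type*} [Primcodable α] {f g : α → ℕ} (hf : Primrec f)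
    (hg : Primrec g) : Primrec fun a => ask (f a) (g a) := by
  unfold ask
  fun_prop

/-- `i` is an index of the graph of `f` as a set `Σ₁` in `Y` and `O`. -/
def GRi (i : ℕ) (f Y O : ℕ → ℕ) : Prop := ∀ x v, f x = v ↔ J2 (ask i (Nat.pair x v)) Y O

/-- The graph of `f` is `Σ₁` in `Y` and `O`. -/
def GR (f Y O : ℕ → ℕ) : Prop := ∃ i, GRi i f Y O

theorem GR.of_search {M : ℕ → ℕ → List ℕ → List ℕ → Prop}
    (hM : PrimrecPred fun x : ℕ × ℕ × List ℕ × List ℕ => M x.1 x.2.1 x.2.2.1 x.2.2.2)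
    {f Y O : ℕ → ℕ} (h : ∀ x v, f x = v ↔ ∃ K, M x v (initSeg Y K) (initSeg O K)) :
    GR f Y O := by
  obtain ⟨p, hp⟩ := exists_universal_index
    (M := fun y τ α => M y.unpair.2.unpair.1 y.unpair.2.unpair.2 τ α)
    (hM.comp (f := fun x : ℕ × List ℕ × List ℕ =>
      (x.1.unpair.2.unpair.1, x.1.unpair.2.unpair.2, x.2)) (by fun_prop))
  refine ⟨Nat.pair p 0, fun x v => ?_⟩
  rw [ask_pair, hp, h]
  simp

/-- The string `u` is verified to be an initial segment of the function with index `i`. -/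
def Approx (i : ℕ) (u τ α : List ℕ) : Prop :=
  ∀ j < u.length, Sm (ask i (Nat.pair j (u.getD j 0))) τ α

@[fun_prop] theorem primrecPred_Approx {α : Type*} [Primcodable α] {i : α → ℕ}
    {u s t : α → List ℕ} (hi : Primrec i) (hu : Primrec u) (hs : Primrec s) (ht : Primrec t) :
    PrimrecPred fun a => Approx (i a) (u a) (s a) (t a) := by
  unfold Approx
  fun_prop

theorem Approx.isInit {i : ℕ} {f Y O : ℕ → ℕ} {u τ α : List ℕ} (h : Approx i u τ α)
    (hf : GRi i f Y O) (hτ : IsInit τ Y) (hα : IsInit α O) : IsInit u f := by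
  rw [isInit_iff_getElem?]
  intro j hj
  rw [(hf j _).2 ((h j hj).j2 hτ hα)]
  simp [List.getD_eq_getElem?_getD, List.getElem?_eq_getElem hj]

theorem GRi.approx_eventually {i : ℕ} {f Y O : ℕ → ℕ} (hf : GRi i f Y O) {u : List ℕ}
    (hu : IsInit u f) : ∀ᶠ K in atTop, Approx i u (initSeg Y K) (initSeg O K) := by
  have : ∀ᶠ K in atTop, ∀ j ∈ Set.Iio u.length,
      Sm (ask i (Nat.pair j (u.getD j 0))) (initSeg Y K) (initSeg O K) := by
    rw [eventually_all_finite (Set.finite_Iio _)]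
    intro j hj
    exact ((hf j _).1 (hu.getD hj 0).symm).eventually
  exact this

theorem GR.trans {f g h O : ℕ → ℕ} (h1 : GR f g O) (h2 : GR g h O) : GR f h O := by
  obtain ⟨i, hi⟩ := h1
  obtain ⟨j, hj⟩ := h2
  refine GR.of_search (M := fun x v τ α => ∃ k < α.length, Approx j (strOf k) τ α ∧
    Sm (ask i (Nat.pair x v)) (strOf k) α) (by fun_prop) fun x v => ?_
  constructor
  · intro hx
    obtain ⟨L, hL⟩ := (hi x v).1 hx
    have hA := hj.approx_eventually (isInit_initSeg g L)
    obtain ⟨K, hK, hK1, hK2⟩ := (hA.and ((eventually_gt_atTop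
      (Encodable.encode (initSeg g L))).and (eventually_ge_atTop L))).exists
    refine ⟨K, Encodable.encode (initSeg g L), by simpa using hK1, ?_, ?_⟩
    · simpa using hK
    · simpa using hL.mono List.prefix_rfl (initSeg_prefix O hK2)
  · rintro ⟨K, k, -, hA, hS⟩
    exact (hi x v).2 (hS.j2 (hA.isInit hj (isInit_initSeg _ _) (isInit_initSeg _ _))
      (isInit_initSeg _ _))

theorem GR.of_tRedIn {f g : ℕ → ℕ} (h : TRedIn f g) (O : ℕ → ℕ) : GR f g O := by
  obtain ⟨c, hc⟩ := h
  refine GR.of_search (M := fun x v τ _ => ∃ j ≤ τ.length,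
    Code.evaln τ.length c.toCode (Nat.pair (Encodable.encode (τ.take j)) x) = some v)
    (by fun_prop) fun x v => ?_
  have : f x = v ↔ v ∈ evalo g c x := by
    rw [hc x]
    simp [eq_comm]
  rw [this, mem_evalo_iff]
  refine exists_congr fun K => ?_
  simp only [initSeg_length]
  refine exists_congr fun j => and_congr_right fun hj => ?_
  rw [initSeg_take_of_le _ hj]

/-! ### The jump -/

/-- The computation defining the jump at `e` converges with finite oracle `u`. -/
def JumpHalts (e : ℕ) (u : List ℕ) : Prop :=
  ∃ j ≤ u.length, (Code.evaln u.length (OCode.ofNat e).toCode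
    (Nat.pair (Encodable.encode (u.take j)) e)).isSome = true

@[fun_prop] theorem primrecPred_JumpHalts {α : Type*} [Primcodable α] {e : α → ℕ}
    {u : α → List ℕ} (he : Primrec e) (hu : Primrec u) :
    PrimrecPred fun a => JumpHalts (e a) (u a) := by
  have h : Primrec fun x : α × ℕ => (OCode.ofNat (e x.1)).toCode :=
    primrec_toCode_ofNat.comp (he.comp Primrec.fst)
  unfold JumpHalts
  fun_prop

theorem dom_iff_jumpHalts {f : ℕ → ℕ} {e : ℕ} :
    (evalo f (OCode.ofNat e) e).Dom ↔ ∃ K, JumpHalts e (initSeg f K) := by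
  rw [Part.dom_iff_mem]
  simp only [mem_evalo_iff]
  constructor
  · rintro ⟨y, K, j, hj, h⟩
    refine ⟨K, j, by simpa using hj, ?_⟩
    rw [initSeg_take_of_le _ hj, initSeg_length, h]
    rfl
  · rintro ⟨K, j, hj, h⟩
    rw [initSeg_length] at hj h
    obtain ⟨y, hy⟩ := Option.isSome_iff_exists.1 h
    rw [initSeg_take_of_le _ hj] at hy
    exact ⟨y, K, j, hj, hy⟩

theorem jump_eq_one_iff {f : ℕ → ℕ} {e : ℕ} :
    jump f e = 1 ↔ ∃ K, JumpHalts e (initSeg f K) := by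
  rw [← dom_iff_jumpHalts, jump]
  split_ifs with h <;> simp [h]

theorem exists_jump_index : ∃ m, ∀ p e f Y O, GRi p f Y O →
    (J2 (Nat.pair m (Nat.pair p e)) Y O ↔ jump f e = 1) := by
  obtain ⟨m, hm⟩ := exists_universal_index (M := fun y τ α => ∃ k < α.length,
    JumpHalts y.unpair.2 (strOf k) ∧ Approx y.unpair.1 (strOf k) τ α) (by fun_prop)
  refine ⟨m, fun p e f Y O hp => ?_⟩
  rw [hm, jump_eq_one_iff]
  simp only [Nat.unpair_pair, initSeg_length]
  constructor
  · rintro ⟨K, k, -, hk, hA⟩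
    have := hA.isInit hp (isInit_initSeg _ _) (isInit_initSeg _ _)
    exact ⟨_, this ▸ hk⟩
  · rintro ⟨L, hL⟩
    obtain ⟨K, hK, hK1⟩ := ((hp.approx_eventually (isInit_initSeg f L)).and
      (eventually_gt_atTop (Encodable.encode (initSeg f L)))).exists
    exact ⟨K, _, hK1, by simpa using hL, by simpa using hK⟩

theorem getElem?_of_prefix {σ τ : List ℕ} (h : σ <+: τ) {i : ℕ} (hi : i < σ.length) :
    τ[i]? = σ[i]? := by
  obtain ⟨ρ, rfl⟩ := h
  exact List.getElem?_append_left hi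

/-! ### Tree maps built by successive extensions -/

/-- The tree map which applies the extension operator `E e` at level `e`. -/
def extMap (E : ℕ → List ℕ → List ℕ) (σ : List ℕ) : List ℕ :=
  (σ.foldl (fun s i => (s.1 + 1, E s.1 (s.2 ++ [i]))) ((0, []) : ℕ × List ℕ)).2

section ExtMap

variable {E : ℕ → List ℕ → List ℕ}

@[simp] theorem extMap_nil : extMap E [] = [] := rfl

theorem extMap_concat (σ : List ℕ) (i : ℕ) :
    extMap E (σ ++ [i]) = E σ.length (extMap E σ ++ [i]) := by
  have h : ∀ σ : List ℕ, (σ.foldl (fun s i => (s.1 + 1, E s.1 (s.2 ++ [i])))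
      ((0, []) : ℕ × List ℕ)).1 = σ.length := by
    intro σ
    induction σ using List.reverseRecOn with
    | nil => rfl
    | append_singleton σ i ih => simp [ih]
  simp [extMap, h]

theorem extMap_concat_prefix (hE : ∀ e β, β <+: E e β) (σ : List ℕ) (i : ℕ) :
    extMap E σ ++ [i] <+: extMap E (σ ++ [i]) := by
  rw [extMap_concat]
  exact hE _ _

theorem extMap_mono (hE : ∀ e β, β <+: E e β) {σ τ : List ℕ} (h : σ <+: τ) :
    extMap E σ <+: extMap E τ := by
  obtain ⟨ρ, rfl⟩ := h
  induction ρ using List.reverseRecOn with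
  | nil => simp
  | append_singleton ρ i ih =>
    rw [← List.append_assoc]
    exact ih.trans ((List.prefix_append _ _).trans (extMap_concat_prefix hE _ _))

theorem length_le_extMap (hE : ∀ e β, β <+: E e β) (σ : List ℕ) :
    σ.length ≤ (extMap E σ).length := by
  induction σ using List.reverseRecOn with
  | nil => simp
  | append_singleton σ i ih =>
    have := (extMap_concat_prefix hE σ i).length_le
    simp at this ⊢
    omega

theorem extMap_eventually {E' : ℕ → ℕ → List ℕ → List ℕ}
    (h : ∀ e β, ∀ᶠ t in atTop, E' t e β = E e β) (σ : List ℕ) :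
    ∀ᶠ t in atTop, extMap (E' t) σ = extMap E σ := by
  induction σ using List.reverseRecOn with
  | nil => simp
  | append_singleton σ i ih =>
    filter_upwards [ih, h σ.length (extMap E σ ++ [i])] with t h1 h2
    rw [extMap_concat, extMap_concat, h1, h2]

/-- The map on points induced by `extMap E`. -/
def extPath (E : ℕ → List ℕ → List ℕ) (s : ℕ → ℕ) : ℕ → ℕ :=
  fun m => (extMap E (initSeg s (m + 1))).getD m 0

theorem isInit_extPath (hE : ∀ e β, β <+: E e β) (s : ℕ → ℕ) (k : ℕ) :
    IsInit (extMap E (initSeg s k)) (extPath E s) := by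
  rw [isInit_iff_getElem?]
  intro i hi
  have hlt : i < (extMap E (initSeg s (i + 1))).length := by
    have := length_le_extMap hE (initSeg s (i + 1))
    simp at this
    omega
  have h1 : (extMap E (initSeg s (i + 1)))[i]? = some (extPath E s i) := by
    simp [extPath, List.getD_eq_getElem?_getD, List.getElem?_eq_getElem hlt]
  rw [← h1]
  rcases le_total k (i + 1) with h | h
  · exact (getElem?_of_prefix (extMap_mono hE (initSeg_prefix s h)) hi).symm
  · exact getElem?_of_prefix (extMap_mono hE (initSeg_prefix s h)) hlt

theorem isInit_extMap_of_isInit (hE : ∀ e β, β <+: E e β) {s : ℕ → ℕ} {σ : List ℕ}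
    (h : IsInit σ s) : IsInit (extMap E σ) (extPath E s) := by
  rw [h]
  exact isInit_extPath hE s _

theorem eq_extPath (hE : ∀ e β, β <+: E e β) {s y : ℕ → ℕ}
    (h : ∀ k, IsInit (extMap E (initSeg s k)) y) : y = extPath E s := by
  funext m
  have hlt : m < (extMap E (initSeg s (m + 1))).length := by
    have := length_le_extMap hE (initSeg s (m + 1))
    simp at this
    omega
  rw [← (h (m + 1)).getD hlt 0, ← (isInit_extPath hE s (m + 1)).getD hlt 0]

theorem isInit_of_extMap (hE : ∀ e β, β <+: E e β) {s : ℕ → ℕ} {σ : List ℕ}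
    (h : IsInit (extMap E σ) (extPath E s)) : IsInit σ s := by
  induction σ using List.reverseRecOn with
  | nil => simp [IsInit]
  | append_singleton σ i ih =>
    have h1 := h.of_prefix (extMap_concat_prefix hE σ i)
    have h2 := ih (h1.of_prefix (List.prefix_append _ _))
    refine IsInit.append_singleton.2 ⟨h2, ?_⟩
    have h3 : IsInit (σ ++ [s σ.length]) s := IsInit.append_singleton.2 ⟨h2, rfl⟩
    have h4 := (isInit_extMap_of_isInit hE h3).of_prefix (extMap_concat_prefix hE σ _)
    rw [← (IsInit.append_singleton.1 h4).2, (IsInit.append_singleton.1 h1).2]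

end ExtMap

/-! ### Forcing extensions -/

/-- Search for an extension of `β` forcing a positive answer to question `e`. -/
noncomputable def findExt (e : ℕ) (β α : List ℕ) : Option ℕ :=
  leastLt α.length fun k => Sm e (β ++ strOf k.unpair.1) (α.take k.unpair.2)

/-- Extend `β` so as to force question `e`, as far as `α` shows. -/
noncomputable def forceExt (α : List ℕ) (e : ℕ) (β : List ℕ) : List ℕ :=
  (findExt e β α).elim β fun k => β ++ strOf k.unpair.1

/-- Extend `β` so as to force question `e` relative to the oracle `O`. -/
noncomputable def forceLim (O : ℕ → ℕ) (e : ℕ) (β : List ℕ) : List ℕ :=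
  if h : ∃ k : ℕ, Sm e (β ++ strOf k.unpair.1) (initSeg O k.unpair.2) then
    β ++ strOf (Nat.find h).unpair.1
  else β

/-- Finite approximation of the forcing tree map. -/
noncomputable def forceMap (α σ : List ℕ) : List ℕ := extMap (forceExt α) σ

section
variable {ι : Type*} [Primcodable ι]

@[fun_prop] theorem primrec_findExt {e : ι → ℕ} {b a : ι → List ℕ} (he : Primrec e)
    (hb : Primrec b) (ha : Primrec a) : Primrec fun x => findExt (e x) (b x) (a x) := by
  unfold findExt
  fun_prop

@[fun_prop] theorem primrec_forceExt {e : ι → ℕ} {b a : ι → List ℕ} (he : Primrec e)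
    (hb : Primrec b) (ha : Primrec a) : Primrec fun x => forceExt (a x) (e x) (b x) := by
  unfold forceExt
  fun_prop

@[fun_prop] theorem primrec_forceMap {a s : ι → List ℕ} (ha : Primrec a)
    (hs : Primrec s) : Primrec fun x => forceMap (a x) (s x) := by
  unfold forceMap extMap
  fun_prop

end

theorem findExt_initSeg {O : ℕ → ℕ} {e t : ℕ} {β : List ℕ} : findExt e β (initSeg O t) =
    leastLt t fun k => Sm e (β ++ strOf k.unpair.1) (initSeg O k.unpair.2) := by
  have h : ∀ k < t, (initSeg O t).take k.unpair.2 = initSeg O k.unpair.2 := fun k hk =>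
    initSeg_take_of_le O ((Nat.unpair_right_le k).trans hk.le)
  rw [findExt, initSeg_length]
  rcases hc : leastLt t fun k => Sm e (β ++ strOf k.unpair.1) (initSeg O k.unpair.2) with _ | k
  · rw [leastLt_eq_none] at hc ⊢
    intro j hj
    rw [h j hj]
    exact hc j hj
  · rw [leastLt_eq_some] at hc ⊢
    refine ⟨by rw [h k hc.2.1]; exact hc.1, hc.2.1, fun j hj => ?_⟩
    rw [h j (hj.trans hc.2.1)]
    exact hc.2.2 j hj

theorem findExt_eventually {O : ℕ → ℕ} {e : ℕ} {β : List ℕ} :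
    (∃ k : ℕ, Sm e (β ++ strOf k.unpair.1) (initSeg O k.unpair.2) ∧
      ∀ᶠ t in atTop, findExt e β (initSeg O t) = some k) ∨
    ((∀ k : ℕ, ¬ Sm e (β ++ strOf k.unpair.1) (initSeg O k.unpair.2)) ∧
      ∀ t, findExt e β (initSeg O t) = none) := by
  by_cases h : ∃ k : ℕ, Sm e (β ++ strOf k.unpair.1) (initSeg O k.unpair.2)
  · left
    refine ⟨Nat.find h, Nat.find_spec h, ?_⟩
    filter_upwards [eventually_gt_atTop (Nat.find h)] with t ht
    rw [findExt_initSeg, leastLt_eq_some]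
    exact ⟨Nat.find_spec h, ht, fun j hj => Nat.find_min h hj⟩
  · right
    rw [not_exists] at h
    refine ⟨h, fun t => ?_⟩
    rw [findExt_initSeg, leastLt_eq_none]
    exact fun j _ => h j

theorem prefix_forceExt (α : List ℕ) (e : ℕ) (β : List ℕ) : β <+: forceExt α e β := by
  unfold forceExt
  cases findExt e β α <;> simp

theorem prefix_forceLim (O : ℕ → ℕ) (e : ℕ) (β : List ℕ) : β <+: forceLim O e β := by
  unfold forceLim
  split_ifs <;> simp

theorem forceLim_spec {O : ℕ → ℕ} {e : ℕ} {β : List ℕ}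
    (h : ∃ k : ℕ, Sm e (β ++ strOf k.unpair.1) (initSeg O k.unpair.2)) :
    ∃ t, Sm e (forceLim O e β) (initSeg O t) := by
  rw [forceLim, dif_pos h]
  exact ⟨_, Nat.find_spec h⟩

theorem forceExt_eventually (O : ℕ → ℕ) (e : ℕ) (β : List ℕ) :
    ∀ᶠ t in atTop, forceExt (initSeg O t) e β = forceLim O e β := by
  by_cases h : ∃ k : ℕ, Sm e (β ++ strOf k.unpair.1) (initSeg O k.unpair.2)
  · filter_upwards [eventually_gt_atTop (Nat.find h)] with t ht
    have : findExt e β (initSeg O t) = some (Nat.find h) := by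
      rw [findExt_initSeg, leastLt_eq_some]
      exact ⟨Nat.find_spec h, ht, fun j hj => Nat.find_min h hj⟩
    rw [forceExt, this, forceLim, dif_pos h]
    rfl
  · refine Eventually.of_forall fun t => ?_
    have : findExt e β (initSeg O t) = none := by
      rw [findExt_initSeg, leastLt_eq_none]
      exact fun j _ => not_exists.1 h j
    rw [forceExt, this, forceLim, dif_neg h]
    rfl

theorem forceMap_eventually (O : ℕ → ℕ) (σ : List ℕ) :
    ∀ᶠ t in atTop, forceMap (initSeg O t) σ = extMap (forceLim O) σ :=
  extMap_eventually (forceExt_eventually O) σ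

theorem exists_sm_of_j2 {q : ℕ} {y O : ℕ → ℕ} {β : List ℕ} (hβ : IsInit β y) (h : J2 q y O) :
    ∃ k : ℕ, Sm q (β ++ strOf k.unpair.1) (initSeg O k.unpair.2) := by
  obtain ⟨K, hK, hK1⟩ := (h.eventually.and (eventually_ge_atTop β.length)).exists
  obtain ⟨ρ, hρ⟩ := (isInit_iff_prefix hK1).1 hβ
  refine ⟨Nat.pair (Encodable.encode ρ) K, ?_⟩
  simpa [hρ] using hK

theorem j2_extPath_iff {q : ℕ} {s O : ℕ → ℕ} : J2 q (extPath (forceLim O) s) O ↔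
    ∃ t, Sm q (extMap (forceLim O) (initSeg s (q + 1))) (initSeg O t) := by
  have hE := prefix_forceLim O
  constructor
  · intro h
    have hβ : IsInit (extMap (forceLim O) (initSeg s q) ++ [s q]) (extPath (forceLim O) s) := by
      refine (isInit_extPath hE s (q + 1)).of_prefix ?_
      rw [initSeg_succ]
      exact extMap_concat_prefix hE _ _
    have := forceLim_spec (exists_sm_of_j2 hβ h)
    rw [initSeg_succ, extMap_concat, initSeg_length]
    exact this
  · rintro ⟨t, ht⟩
    exact ht.j2 (isInit_extPath hE s _) (isInit_initSeg _ _)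

/-! ### The iterated oracles -/

/-- The `n`-th oracle; its column `i ≤ n` answers the questions about the oracle `i - 1`. -/
noncomputable def orac : ℕ → ℕ → ℕ
  | 0 => zeroF
  | n + 1 => fun m =>
    if m.unpair.1 = n + 1 then (if J2 m.unpair.2 (orac n) (orac n) then 1 else 0) else orac n m

/-- The limit of all oracles. -/
noncomputable def oracLim (m : ℕ) : ℕ := orac m.unpair.1 m

theorem orac_succ (n m : ℕ) : orac (n + 1) m =
    if m.unpair.1 = n + 1 then (if J2 m.unpair.2 (orac n) (orac n) then 1 else 0)
    else orac n m := rfl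

theorem orac_of_lt {n m : ℕ} (h : n < m.unpair.1) : orac n m = 0 := by
  induction n with
  | zero => rfl
  | succ n ih => rw [orac_succ, if_neg h.ne', ih (by omega)]

theorem orac_of_le {n m : ℕ} (h : m.unpair.1 ≤ n) : orac n m = oracLim m := by
  induction n, h using Nat.le_induction with
  | base => rfl
  | succ n hn ih => rw [orac_succ, if_neg (by omega), ih]

theorem orac_eq (n m : ℕ) : orac n m = if m.unpair.1 ≤ n then oracLim m else 0 := by
  split_ifs with h
  · exact orac_of_le h
  · exact orac_of_lt (by omega)

theorem initSeg_orac_eq_lim {n s : ℕ} (h : s ≤ n + 1) : initSeg (orac n) s = initSeg oracLim s :=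
  initSeg_congr fun i hi => orac_of_le ((Nat.unpair_left_le i).trans (by omega))

theorem oracLim_column (n q : ℕ) :
    oracLim (Nat.pair (n + 1) q) = if J2 q (orac n) (orac n) then 1 else 0 := by
  simp [oracLim, orac_succ]

/-- One-step approximation to the next oracle. -/
noncomputable def nextStr (n : ℕ) (α : List ℕ) : List ℕ :=
  (List.range α.length).map fun m =>
    if m.unpair.1 = n + 1 then (if Sm m.unpair.2 α α then 1 else 0) else α.getD m 0

/-- The restriction of a string to the first columns. -/
def truncStr (n : ℕ) (γ : List ℕ) : List ℕ :=
  (List.range γ.length).map fun m => if m.unpair.1 ≤ n then γ.getD m 0 else 0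

section
variable {ι : Type*} [Primcodable ι]

@[fun_prop] theorem primrec_nextStr {n : ι → ℕ} {a : ι → List ℕ} (hn : Primrec n)
    (ha : Primrec a) : Primrec fun x => nextStr (n x) (a x) := by
  unfold nextStr
  fun_prop

@[fun_prop] theorem primrec_truncStr {n : ι → ℕ} {a : ι → List ℕ} (hn : Primrec n)
    (ha : Primrec a) : Primrec fun x => truncStr (n x) (a x) := by
  unfold truncStr
  fun_prop

end

theorem nextStr_eventually (n k : ℕ) :
    ∀ᶠ t in atTop, (nextStr n (initSeg (orac n) t)).take k = initSeg (orac (n + 1)) k := by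
  have h : ∀ m, ∀ᶠ t in atTop, (if m.unpair.1 = n + 1 then
      (if Sm m.unpair.2 (initSeg (orac n) t) (initSeg (orac n) t) then 1 else 0)
      else (initSeg (orac n) t).getD m 0) = orac (n + 1) m := by
    intro m
    by_cases hm : m.unpair.1 = n + 1
    · by_cases hJ : J2 m.unpair.2 (orac n) (orac n)
      · filter_upwards [hJ.eventually] with t ht
        simp [orac_succ, hm, hJ, ht]
      · refine Eventually.of_forall fun t => ?_
        have : ¬ Sm m.unpair.2 (initSeg (orac n) t) (initSeg (orac n) t) := fun hS => hJ ⟨t, hS⟩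
        simp [orac_succ, hm, hJ, this]
    · filter_upwards [eventually_gt_atTop m] with t ht
      rw [if_neg hm, initSeg_getD _ ht, orac_succ, if_neg hm]
  have h2 : ∀ᶠ t in atTop, ∀ m ∈ Set.Iio k, (if m.unpair.1 = n + 1 then
      (if Sm m.unpair.2 (initSeg (orac n) t) (initSeg (orac n) t) then 1 else 0)
      else (initSeg (orac n) t).getD m 0) = orac (n + 1) m :=
    (eventually_all_finite (Set.finite_Iio k)).2 fun m _ => h m
  filter_upwards [h2, eventually_ge_atTop k] with t ht hk
  rw [nextStr, initSeg_length, ← List.map_take, List.take_range, min_eq_left hk]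
  exact List.map_congr_left fun m hm => ht m (List.mem_range.1 hm)

theorem truncStr_lim (n K : ℕ) : truncStr n (initSeg oracLim K) = initSeg (orac n) K := by
  rw [truncStr, initSeg_length]
  refine List.map_congr_left fun m hm => ?_
  rw [initSeg_getD _ (List.mem_range.1 hm), orac_eq]

/-! ### The local conditions -/

/-- First components of a string of coded pairs. -/
def fstStr (ρ : List ℕ) : List ℕ := ρ.map fun v => v.unpair.1

/-- The last entry of a string. -/
def lastEntry (ρ : List ℕ) : ℕ := ρ.getD (ρ.length - 1) 0

/-- The guesses recorded in `l` agree up to `m` with the guesses made from the string `β`. -/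
def Agree (D : List ℕ → ℕ → ℕ) (β l : List ℕ) (m : ℕ) : Prop :=
  ∀ x ≤ m, D (β.take (l.length - 1)) x = (l.getD x 0).unpair.1

/-- The moduli recorded in `l` are not refuted at stage `l.length - 1`. -/
def RowOK (D : List ℕ → ℕ → ℕ) (β l : List ℕ) : Prop :=
  l.length - 1 ≤ β.length ∧ l.length - 1 ≤ (lastEntry l).unpair.2 ∧
    ∀ m ≤ l.length - 1, ((l.getD m 0).unpair.2 ≤ l.length - 1 ∨ ¬ Agree D β l m) ∧
      (l.length - 1 ≠ (l.getD m 0).unpair.2 ∨ Agree D β l m)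

/-- The program `c` accepts `x` within `s` steps. -/
def Accepts (c : Code) (s : ℕ) (x : List ℕ × List ℕ × List ℕ) : Prop :=
  c.evaln s (Encodable.encode x) = some 1

/-- The string `σ` is a plausible preimage of `y`, as far as `β` shows. -/
def PreOK (D : List ℕ → ℕ → ℕ) (c : Code) (l β y σ : List ℕ) : Prop :=
  y.length ≤ β.length ∧ σ.length = y.length ∧ y <+: forceMap β σ ∧
    RowOK D β (l ++ [σ.headI]) ∧ ∀ i ≤ σ.tail.length, Accepts c β.length
      (l ++ [σ.headI], (nextStr l.length β).take (lastEntry (σ.tail.take i)), σ.tail.take i)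

/-- `v` codes a stage and a plausible preimage of `y` at that stage. -/
def PreCode (D : List ℕ → ℕ → ℕ) (c : Code) (l α y : List ℕ) (v : ℕ) : Prop :=
  v.unpair.1 ≤ α.length ∧ PreOK D c l (α.take v.unpair.1) y (strOf v.unpair.2)

/-- The last entry of `ρ` carries the least code of a plausible preimage. -/
def NodeOK (D : List ℕ → ℕ → ℕ) (c : Code) (l α ρ : List ℕ) : Prop :=
  ρ = [] ∨ (PreCode D c l α (fstStr ρ) (lastEntry ρ).unpair.2 ∧
    ∀ v < (lastEntry ρ).unpair.2, ¬ PreCode D c l α (fstStr ρ) v)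

section Primrec
variable {ι : Type*} [Primcodable ι] {D : List ℕ → ℕ → ℕ}

@[fun_prop] theorem primrec_fstStr {f : ι → List ℕ} (hf : Primrec f) :
    Primrec fun x => fstStr (f x) := by
  unfold fstStr
  fun_prop

@[fun_prop] theorem primrec_lastEntry {f : ι → List ℕ} (hf : Primrec f) :
    Primrec fun x => lastEntry (f x) := by
  unfold lastEntry
  fun_prop

@[fun_prop] theorem primrecPred_Agree (hD : Primrec fun p : List ℕ × ℕ => D p.1 p.2)
    {b l : ι → List ℕ} {m : ι → ℕ} (hb : Primrec b) (hl : Primrec l) (hm : Primrec m) :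
    PrimrecPred fun x => Agree D (b x) (l x) (m x) := by
  unfold Agree
  fun_prop

@[fun_prop] theorem primrecPred_RowOK (hD : Primrec fun p : List ℕ × ℕ => D p.1 p.2)
    {b l : ι → List ℕ} (hb : Primrec b) (hl : Primrec l) :
    PrimrecPred fun x => RowOK D (b x) (l x) := by
  unfold RowOK
  fun_prop

@[fun_prop] theorem primrecPred_Accepts {c : ι → Code} {s : ι → ℕ}
    {z : ι → List ℕ × List ℕ × List ℕ} (hc : Primrec c) (hs : Primrec s) (hz : Primrec z) :
    PrimrecPred fun x => Accepts (c x) (s x) (z x) := by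
  unfold Accepts
  fun_prop

@[fun_prop] theorem primrecPred_PreOK (hD : Primrec fun p : List ℕ × ℕ => D p.1 p.2)
    {c : ι → Code} {l b y s : ι → List ℕ} (hc : Primrec c) (hl : Primrec l) (hb : Primrec b)
    (hy : Primrec y) (hs : Primrec s) :
    PrimrecPred fun x => PreOK D (c x) (l x) (b x) (y x) (s x) := by
  unfold PreOK
  fun_prop

@[fun_prop] theorem primrecPred_PreCode (hD : Primrec fun p : List ℕ × ℕ => D p.1 p.2)
    {c : ι → Code} {l b y : ι → List ℕ} {v : ι → ℕ} (hc : Primrec c) (hl : Primrec l)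
    (hb : Primrec b) (hy : Primrec y) (hv : Primrec v) :
    PrimrecPred fun x => PreCode D (c x) (l x) (b x) (y x) (v x) := by
  unfold PreCode
  fun_prop

@[fun_prop] theorem primrecPred_NodeOK (hD : Primrec fun p : List ℕ × ℕ => D p.1 p.2)
    {c : ι → Code} {l b y : ι → List ℕ} (hc : Primrec c) (hl : Primrec l)
    (hb : Primrec b) (hy : Primrec y) :
    PrimrecPred fun x => NodeOK D (c x) (l x) (b x) (y x) := by
  unfold NodeOK
  fun_prop

end Primrec

/-- A program deciding `NodeOK` for itself. -/
theorem exists_self_code {D : List ℕ → ℕ → ℕ} (hD : Primrec fun p : List ℕ × ℕ => D p.1 p.2) :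
    ∃ c : Code, ∀ l α ρ, c.eval (Encodable.encode (l, α, ρ)) =
      Part.some (if NodeOK D c l α ρ then 1 else 0) := by
  have h : Primrec fun p : Code × ℕ =>
      if NodeOK D p.1 (Denumerable.ofNat (List ℕ × List ℕ × List ℕ) p.2).1
        (Denumerable.ofNat (List ℕ × List ℕ × List ℕ) p.2).2.1
        (Denumerable.ofNat (List ℕ × List ℕ × List ℕ) p.2).2.2 then 1 else 0 := by
    fun_prop
  obtain ⟨c, hc⟩ := Code.fixed_point₂ (f := fun c x => Part.some
      (if NodeOK D c (Denumerable.ofNat (List ℕ × List ℕ × List ℕ) x).1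
        (Denumerable.ofNat (List ℕ × List ℕ × List ℕ) x).2.1
        (Denumerable.ofNat (List ℕ × List ℕ × List ℕ) x).2.2 then 1 else 0)) h.to_comp.partrec
  refine ⟨c, fun l α ρ => ?_⟩
  rw [hc]
  simp

/-! ### Points satisfying the local conditions -/

/-- Pointwise first components. -/
def fstF (Y : ℕ → ℕ) : ℕ → ℕ := fun m => (Y m).unpair.1

theorem fstStr_initSeg (Y : ℕ → ℕ) (k : ℕ) : fstStr (initSeg Y k) = initSeg (fstF Y) k := by
  simp [fstStr, initSeg, fstF]

theorem lastEntry_initSeg (Y : ℕ → ℕ) (k : ℕ) : lastEntry (initSeg Y (k + 1)) = Y k := by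
  rw [lastEntry, initSeg_length, initSeg_getD _ (by omega)]
  rfl

/-- `NodeOK` evaluated with the true `n`-th oracle. -/
def TrueNode (D : List ℕ → ℕ → ℕ) (c : Code) (n : ℕ) (l ρ : List ℕ) : Prop :=
  NodeOK D c l (initSeg (orac n) (lastEntry ρ)) ρ

/-- `PreOK` at the stage coded by `v` with the true `n`-th oracle. -/
def TruePre (D : List ℕ → ℕ → ℕ) (c : Code) (n : ℕ) (l y : List ℕ) (v : ℕ) : Prop :=
  PreOK D c l (initSeg (orac n) v.unpair.1) y (strOf v.unpair.2)

/-- All initial segments of `Y` satisfy the conditions of level `n`. -/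
def GoodPoint (D : List ℕ → ℕ → ℕ) (c : Code) (n : ℕ) (l : List ℕ) (Y : ℕ → ℕ) : Prop :=
  ∀ k, TrueNode D c n l (initSeg Y k)

section
variable {D : List ℕ → ℕ → ℕ} {c : Code}

theorem preCode_initSeg {n N v : ℕ} {l y : List ℕ} (h : v ≤ N) :
    PreCode D c l (initSeg (orac n) N) y v ↔ TruePre D c n l y v := by
  have h1 : v.unpair.1 ≤ N := (Nat.unpair_left_le v).trans h
  rw [PreCode, TruePre, initSeg_length, initSeg_take_of_le _ h1]
  exact and_iff_right h1

theorem trueNode_succ {n m : ℕ} {l : List ℕ} {Y : ℕ → ℕ} :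
    TrueNode D c n l (initSeg Y (m + 1)) ↔
      TruePre D c n l (initSeg (fstF Y) (m + 1)) (Y m).unpair.2 ∧
      ∀ v < (Y m).unpair.2, ¬ TruePre D c n l (initSeg (fstF Y) (m + 1)) v := by
  have h0 : initSeg Y (m + 1) ≠ [] := by
    rw [← List.length_pos_iff]
    simp [initSeg_length]
  have hle : (Y m).unpair.2 ≤ Y m := Nat.unpair_right_le _
  rw [TrueNode, NodeOK, or_iff_right h0, fstStr_initSeg, lastEntry_initSeg, preCode_initSeg hle]
  refine and_congr_right fun _ => forall₂_congr fun v hv => ?_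
  rw [preCode_initSeg (hv.le.trans hle)]

theorem trueNode_zero {n : ℕ} {l : List ℕ} {Y : ℕ → ℕ} : TrueNode D c n l (initSeg Y 0) := by
  rw [initSeg_zero]
  exact Or.inl rfl

theorem accepts_eventually (hc : ∀ l α ρ, c.eval (Encodable.encode (l, α, ρ)) =
    Part.some (if NodeOK D c l α ρ then 1 else 0)) (n : ℕ) (l ρ : List ℕ) :
    ∀ᶠ t in atTop, (Accepts c t (l, (nextStr n (initSeg (orac n) t)).take (lastEntry ρ), ρ) ↔
      TrueNode D c (n + 1) l ρ) := by
  have key : ∀ᶠ t in atTop, (Accepts c t (l, initSeg (orac (n + 1)) (lastEntry ρ), ρ) ↔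
      TrueNode D c (n + 1) l ρ) := by
    have h := hc l (initSeg (orac (n + 1)) (lastEntry ρ)) ρ
    by_cases hT : TrueNode D c (n + 1) l ρ
    · have hT' := hT
      rw [TrueNode] at hT'
      rw [if_pos hT', Part.eq_some_iff, Code.evaln_complete] at h
      obtain ⟨k, hk⟩ := h
      filter_upwards [eventually_ge_atTop k] with t ht
      exact iff_of_true (Code.evaln_mono ht hk) hT
    · have hT' := hT
      rw [TrueNode] at hT'
      rw [if_neg hT'] at h
      refine Eventually.of_forall fun t => iff_of_false (fun hA => ?_) hT
      have := Code.evaln_sound (Option.mem_def.2 hA)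
      rw [h] at this
      simp at this
  filter_upwards [key, nextStr_eventually n (lastEntry ρ)] with t h1 h2
  rw [h2]
  exact h1

/-- `RowOK` evaluated with the true oracle. -/
def TrueRow (D : List ℕ → ℕ → ℕ) (l : List ℕ) : Prop :=
  RowOK D (initSeg oracLim (l.length - 1)) l

theorem rowOK_iff {n t : ℕ} {l : List ℕ} (hl : l.length = n + 1) :
    RowOK D (initSeg (orac n) t) l ↔ n ≤ t ∧ TrueRow D l := by
  have hn : l.length - 1 = n := by omega
  have key : n ≤ t → ∀ m, (Agree D (initSeg (orac n) t) l m ↔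
      Agree D (initSeg oracLim n) l m) := by
    intro h m
    rw [Agree, Agree, hn, initSeg_take_of_le _ h, initSeg_take_of_le _ le_rfl,
      initSeg_orac_eq_lim (Nat.le_succ n)]
  rw [TrueRow, RowOK, RowOK, hn, initSeg_length, initSeg_length]
  constructor
  · rintro ⟨h1, h2, h3⟩
    simp only [key h1] at h3
    exact ⟨h1, le_rfl, h2, h3⟩
  · rintro ⟨h1, -, h2, h3⟩
    simp only [key h1]
    exact ⟨h1, h2, h3⟩

/-- The least modulus at `m` of the convergence of the guesses to `A`. -/
noncomputable def modulus (D : List ℕ → ℕ → ℕ) (A : ℕ → ℕ) (m : ℕ) : ℕ :=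
  sInf {s | m ≤ s ∧ ∀ x ≤ m, D (initSeg oracLim s) x = A x}

/-- The sequence `A` together with its moduli. -/
noncomputable def trueRow (D : List ℕ → ℕ → ℕ) (A : ℕ → ℕ) (m : ℕ) : ℕ :=
  Nat.pair (A m) (modulus D A m)

section Row
variable {A : ℕ → ℕ}

theorem modulus_spec (hA : ∀ x, ∀ᶠ t in atTop, D (initSeg oracLim t) x = A x) (m : ℕ) :
    m ≤ modulus D A m ∧ ∀ x ≤ m, D (initSeg oracLim (modulus D A m)) x = A x := by
  have h : ∀ᶠ t in atTop, ∀ x ∈ Set.Iic m, D (initSeg oracLim t) x = A x :=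
    (eventually_all_finite (Set.finite_Iic m)).2 fun x _ => hA x
  obtain ⟨s, hs, hm⟩ := (h.and (eventually_ge_atTop m)).exists
  exact Nat.sInf_mem (s := {s | m ≤ s ∧ ∀ x ≤ m, D (initSeg oracLim s) x = A x}) ⟨s, hm, hs⟩

theorem not_of_lt_modulus {m s : ℕ} (hm : m ≤ s) (h : s < modulus D A m) :
    ¬ ∀ x ≤ m, D (initSeg oracLim s) x = A x := fun hs =>
  Nat.notMem_of_lt_sInf h ⟨hm, hs⟩

theorem trueRow_iff {b : ℕ → ℕ} {n : ℕ} : TrueRow D (initSeg b (n + 1)) ↔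
    n ≤ (b n).unpair.2 ∧ ∀ m ≤ n,
      ((b m).unpair.2 ≤ n ∨ ¬ ∀ x ≤ m, D (initSeg oracLim n) x = (b x).unpair.1) ∧
      (n ≠ (b m).unpair.2 ∨ ∀ x ≤ m, D (initSeg oracLim n) x = (b x).unpair.1) := by
  have key : ∀ m ≤ n, (Agree D (initSeg oracLim n) (initSeg b (n + 1)) m ↔
      ∀ x ≤ m, D (initSeg oracLim n) x = (b x).unpair.1) := by
    intro m hm
    refine forall₂_congr fun x hx => ?_
    rw [initSeg_length, Nat.add_sub_cancel, initSeg_take_of_le _ le_rfl,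
      initSeg_getD _ (by omega)]
  rw [TrueRow, RowOK]
  simp only [initSeg_length, Nat.add_sub_cancel, lastEntry_initSeg, le_refl, true_and]
  refine and_congr_right fun _ => forall₂_congr fun m hm => ?_
  rw [key m hm, initSeg_getD _ (by omega)]

theorem trueRow_trueRow (hA : ∀ x, ∀ᶠ t in atTop, D (initSeg oracLim t) x = A x) (n : ℕ) :
    TrueRow D (initSeg (trueRow D A) (n + 1)) := by
  rw [trueRow_iff]
  simp only [trueRow, Nat.unpair_pair]
  refine ⟨(modulus_spec hA n).1, fun m hm => ⟨?_, ?_⟩⟩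
  · by_cases h : modulus D A m ≤ n
    · exact Or.inl h
    · exact Or.inr (not_of_lt_modulus hm (by omega))
  · by_cases h : n = modulus D A m
    · exact Or.inr (h ▸ (modulus_spec hA m).2)
    · exact Or.inl h

theorem eq_trueRow (hA : ∀ x, ∀ᶠ t in atTop, D (initSeg oracLim t) x = A x) {b : ℕ → ℕ}
    (hb : ∀ n, TrueRow D (initSeg b (n + 1))) : b = trueRow D A := by
  simp only [trueRow_iff] at hb
  have h1 : ∀ m, m ≤ (b m).unpair.2 := fun m => (hb m).1
  have h2 : ∀ m, ∀ x ≤ m, D (initSeg oracLim (b m).unpair.2) x = (b x).unpair.1 := fun m =>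
    (((hb (b m).unpair.2).2 m (h1 m)).2).resolve_left (not_not.2 rfl)
  have h3 : ∀ m n, m ≤ n → n < (b m).unpair.2 →
      ¬ ∀ x ≤ m, D (initSeg oracLim n) x = (b x).unpair.1 := fun m n hmn hn =>
    (((hb n).2 m hmn).1).resolve_left (by omega)
  have h4 : ∀ x, (b x).unpair.1 = A x := by
    intro x
    obtain ⟨N, hN⟩ := eventually_atTop.1 (hA x)
    rw [← h2 (max x N) x (le_max_left _ _)]
    exact hN _ ((le_max_right _ _).trans (h1 _))
  simp only [h4] at h2 h3
  funext m
  rw [← Nat.pair_unpair (b m), h4, trueRow]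
  congr 1
  refine le_antisymm ?_ (Nat.sInf_le ⟨h1 m, h2 m⟩)
  by_contra hlt
  exact h3 m _ (modulus_spec hA m).1 (not_le.1 hlt) (modulus_spec hA m).2

end Row

end

/-- The tree map of level `n`. -/
noncomputable def levelMap (n : ℕ) (σ : List ℕ) : List ℕ := extMap (forceLim (orac n)) σ

/-- The map on points of level `n`. -/
noncomputable def levelPath (n : ℕ) (s : ℕ → ℕ) : ℕ → ℕ := extPath (forceLim (orac n)) s

theorem initSeg_consF (b : ℕ) (Y : ℕ → ℕ) (k : ℕ) :
    initSeg (consF b Y) (k + 1) = b :: initSeg Y k := by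
  rw [initSeg_cons]
  rfl

theorem levelMap_eventually (n : ℕ) (σ : List ℕ) :
    ∀ᶠ t in atTop, forceMap (initSeg (orac n) t) σ = levelMap n σ :=
  forceMap_eventually (orac n) σ

/-- The sequence of strings determined by a point in the image of the level map. -/
noncomputable def pullStr (n : ℕ) (y : ℕ → ℕ) : ℕ → List ℕ
  | 0 => []
  | k + 1 => pullStr n y k ++ [y (levelMap n (pullStr n y k)).length]

/-- The preimage of `y` under the level map. -/
noncomputable def pull (n : ℕ) (y : ℕ → ℕ) (k : ℕ) : ℕ :=
  y (levelMap n (pullStr n y k)).length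

theorem initSeg_pull (n : ℕ) (y : ℕ → ℕ) (k : ℕ) : initSeg (pull n y) k = pullStr n y k := by
  induction k with
  | zero => simp [pullStr]
  | succ k ih => rw [initSeg_succ, ih, pullStr, pull]

theorem pull_limit {n : ℕ} {y t : ℕ → ℕ} {σ : ℕ → List ℕ} (ht : Tendsto t atTop atTop)
    (hσ : ∀ m, (σ m).length = m + 1)
    (hy : ∀ m, initSeg y (m + 1) <+: forceMap (initSeg (orac n) (t m)) (σ m)) (k : ℕ) :
    ∀ᶠ m in atTop, (σ m).take k = pullStr n y k ∧ IsInit (levelMap n (pullStr n y k)) y := by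
  have hpre : ∀ m, ∀ α τ : List ℕ, τ <+: σ m → forceMap α τ <+: forceMap α (σ m) :=
    fun m α τ h => extMap_mono (prefix_forceExt α) h
  induction k with
  | zero => simp [pullStr, levelMap, IsInit]
  | succ k ih =>
    set S := pullStr n y k with hS
    have e1 := ht.eventually (levelMap_eventually n S)
    have e2 := ht.eventually (levelMap_eventually n (S ++ [y (levelMap n S).length]))
    filter_upwards [ih, e1, e2, eventually_ge_atTop k, eventually_ge_atTop (levelMap n S).length,
      eventually_ge_atTop (levelMap n (S ++ [y (levelMap n S).length])).length] with
      m ⟨h1, h2⟩ h3 h4 hk hl hl'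
    have hkl : k < (σ m).length := by rw [hσ]; omega
    have htake : (σ m).take (k + 1) = S ++ [(σ m)[k]] := by
      rw [List.take_add_one, h1, List.getElem?_eq_getElem hkl]
      rfl
    have hp : levelMap n S ++ [(σ m)[k]] <+: forceMap (initSeg (orac n) (t m)) (σ m) := by
      rw [← h3]
      refine (extMap_concat_prefix (prefix_forceExt _) S _).trans (hpre m _ _ ?_)
      rw [← htake]
      exact List.take_prefix _ _
    have hi : levelMap n S ++ [(σ m)[k]] <+: initSeg y (m + 1) :=
      List.prefix_of_prefix_length_le hp (hy m) (by simp [initSeg_length]; omega)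
    have hv : y (levelMap n S).length = (σ m)[k] :=
      (IsInit.append_singleton.1 ((isInit_initSeg y _).of_prefix hi)).2
    rw [← hv] at htake
    refine ⟨by rw [htake, pullStr], ?_⟩
    rw [pullStr, ← hS]
    refine (isInit_initSeg y (m + 1)).of_prefix
      (List.prefix_of_prefix_length_le ?_ (hy m) (by simp [initSeg_length]; omega))
    rw [← h4]
    refine hpre m _ _ ?_
    rw [← htake]
    exact List.take_prefix _ _

section
variable {D : List ℕ → ℕ → ℕ} {c : Code}

theorem GoodPoint.exists_next (hc : ∀ l α ρ, c.eval (Encodable.encode (l, α, ρ)) =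
    Part.some (if NodeOK D c l α ρ then 1 else 0)) {l : List ℕ} {Y : ℕ → ℕ}
    (h : GoodPoint D c l.length l Y) : ∃ b Y', GoodPoint D c (l.length + 1) (l ++ [b]) Y' ∧
      fstF Y = levelPath l.length (consF b Y') ∧ TrueRow D (l ++ [b]) := by
  have hpre : ∀ m, TruePre D c l.length l (initSeg (fstF Y) (m + 1)) (Y m).unpair.2 :=
    fun m => (trueNode_succ.1 (h (m + 1))).1
  set n := l.length with hn
  set y := fstF Y with hy
  set t : ℕ → ℕ := fun m => (Y m).unpair.2.unpair.1 with ht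
  set σ : ℕ → List ℕ := fun m => strOf (Y m).unpair.2.unpair.2 with hσ
  have hQ : ∀ m, PreOK D c l (initSeg (orac n) (t m)) (initSeg y (m + 1)) (σ m) := hpre
  have htt : Tendsto t atTop atTop := tendsto_atTop_mono (fun m => by
    have := (hQ m).1
    simp only [initSeg_length] at this
    exact (Nat.le_succ m).trans this) tendsto_id
  have hlim := pull_limit htt (fun m => by simpa [initSeg_length] using (hQ m).2.1)
    (fun m => (hQ m).2.2.1)
  have hcons : consF (pull n y 0) (fun i => pull n y (i + 1)) = pull n y := by
    funext i
    cases i <;> rfl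
  have hhead : ∀ k, ∀ᶠ m in atTop, (σ m).headI = pull n y 0 ∧
      (σ m).tail.take k = initSeg (fun i => pull n y (i + 1)) k ∧ k ≤ (σ m).tail.length := by
    intro k
    filter_upwards [hlim (k + 1), eventually_ge_atTop k] with m hm hk
    have h1 := hm.1
    rw [← initSeg_pull, initSeg_cons] at h1
    have h2 : (σ m).length = m + 1 := by simpa [initSeg_length] using (hQ m).2.1
    cases h3 : σ m with
    | nil => rw [h3] at h2; simp at h2
    | cons i τ =>
      rw [h3, List.take_succ_cons, List.cons.injEq] at h1
      rw [h3, List.length_cons] at h2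
      exact ⟨h1.1, h1.2, by simp; omega⟩
  refine ⟨pull n y 0, fun i => pull n y (i + 1), fun k => ?_, ?_, ?_⟩
  · have e := htt.eventually (accepts_eventually hc n (l ++ [pull n y 0])
      (initSeg (fun i => pull n y (i + 1)) k))
    obtain ⟨m, ⟨h1, h2, h3⟩, h4⟩ := ((hhead k).and e).exists
    have h5 := (hQ m).2.2.2.2 k h3
    rw [h1, h2, initSeg_length] at h5
    exact h4.1 h5
  · rw [hcons]
    refine eq_extPath (prefix_forceLim _) fun k => ?_
    rw [initSeg_pull]
    obtain ⟨m, hm⟩ := (hlim k).exists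
    exact hm.2
  · obtain ⟨m, h1, -⟩ := (hhead 0).exists
    have h2 := (hQ m).2.2.2.1
    rw [h1, rowOK_iff (n := n) (by simp [hn])] at h2
    exact h2.2

/-- A good point of level zero generates a coherent system of good points. -/
theorem GoodPoint.exists_system (hc : ∀ l α ρ, c.eval (Encodable.encode (l, α, ρ)) =
    Part.some (if NodeOK D c l α ρ then 1 else 0)) {Y : ℕ → ℕ} (h : GoodPoint D c 0 [] Y) :
    ∃ (b : ℕ → ℕ) (Z : ℕ → ℕ → ℕ), Z 0 = Y ∧ ∀ n, GoodPoint D c n (initSeg b n) (Z n) ∧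
      fstF (Z n) = levelPath n (consF (b n) (Z (n + 1))) ∧ TrueRow D (initSeg b (n + 1)) := by
  let St := {p : List ℕ × (ℕ → ℕ) // GoodPoint D c p.1.length p.1 p.2}
  choose b Y' hb using fun p : St => p.2.exists_next hc
  let step : St → St := fun p => ⟨(p.1.1 ++ [b p], Y' p), by simpa using (hb p).1⟩
  let s : ℕ → St := fun n => step^[n] ⟨([], Y), h⟩
  have hs : ∀ n, s (n + 1) = step (s n) := fun n => Function.iterate_succ_apply' _ _ _
  have hl : ∀ n, (s n).1.1 = initSeg (fun n => b (s n)) n := by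
    intro n
    induction n with
    | zero => rfl
    | succ n ih => rw [initSeg_succ, ← ih, hs]
  have hlen : ∀ n, (s n).1.1.length = n := fun n => by rw [hl, initSeg_length]
  refine ⟨fun n => b (s n), fun n => (s n).1.2, rfl, fun n => ⟨?_, ?_, ?_⟩⟩
  · have := (s n).2
    rwa [hlen, hl] at this
  · have := (hb (s n)).2.1
    rw [hlen] at this
    change fstF (s n).1.2 = levelPath n (consF (b (s n)) (s (n + 1)).1.2)
    rw [hs]
    exact this
  · have := (hb (s n)).2.2
    rwa [hl, ← initSeg_succ] at this

theorem initSeg_levelPath_congr {n k : ℕ} {s s' : ℕ → ℕ} (h : initSeg s k = initSeg s' k) :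
    initSeg (levelPath n s) k = initSeg (levelPath n s') k := by
  refine initSeg_congr fun i hi => ?_
  have : initSeg s (i + 1) = initSeg s' (i + 1) := by
    rw [← initSeg_take_of_le s (show i + 1 ≤ k from hi), h, initSeg_take_of_le s' hi]
  rw [levelPath, extPath, this]
  rfl

theorem system_unique {a : ℕ → ℕ} {Z Z' : ℕ → ℕ → ℕ}
    (h : ∀ n, GoodPoint D c n (initSeg a n) (Z n) ∧
      fstF (Z n) = levelPath n (consF (a n) (Z (n + 1))))
    (h' : ∀ n, GoodPoint D c n (initSeg a n) (Z' n) ∧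
      fstF (Z' n) = levelPath n (consF (a n) (Z' (n + 1)))) (k : ℕ) :
    ∀ n, initSeg (Z n) k = initSeg (Z' n) k := by
  induction k with
  | zero => simp
  | succ k ih =>
    intro n
    have h1 : initSeg (fstF (Z n)) (k + 1) = initSeg (fstF (Z' n)) (k + 1) := by
      rw [(h n).2, (h' n).2]
      refine initSeg_levelPath_congr ?_
      rw [initSeg_consF, initSeg_consF, ih]
    have h2 : fstF (Z n) k = fstF (Z' n) k := by
      rw [← initSeg_getD (fstF (Z n)) (Nat.lt_succ_self k) 0, h1,
        initSeg_getD _ (Nat.lt_succ_self k)]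
    obtain ⟨p1, p2⟩ := trueNode_succ.1 ((h n).1 (k + 1))
    obtain ⟨q1, q2⟩ := trueNode_succ.1 ((h' n).1 (k + 1))
    rw [h1] at p1 p2
    have h3 : (Z n k).unpair.2 = (Z' n k).unpair.2 := by
      rcases lt_trichotomy (Z n k).unpair.2 (Z' n k).unpair.2 with hlt | heq | hlt
      · exact absurd p1 (q2 _ hlt)
      · exact heq
      · exact absurd q1 (p2 _ hlt)
    rw [initSeg_succ, initSeg_succ, ih]
    congr 2
    rw [← Nat.pair_unpair (Z n k), ← Nat.pair_unpair (Z' n k), h3]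
    congr 1

end

theorem initSeg_levelPath (n : ℕ) (s : ℕ → ℕ) (k : ℕ) :
    initSeg (levelPath n s) k = (levelMap n (initSeg s k)).take k := by
  have h := isInit_extPath (prefix_forceLim (orac n)) s k
  have hl : k ≤ (levelMap n (initSeg s k)).length := by
    have := length_le_extMap (prefix_forceLim (orac n)) (initSeg s k)
    rwa [initSeg_length] at this
  have h2 : levelMap n (initSeg s k) = initSeg (levelPath n s) (levelMap n (initSeg s k)).length := h
  rw [h2, initSeg_take_of_le _ hl]

theorem initSeg_of_chain {u : ℕ → List ℕ} (hl : ∀ k, (u k).length = k)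
    (hp : ∀ k, u k <+: u (k + 1)) (k : ℕ) :
    initSeg (fun m => (u (m + 1)).getD m 0) k = u k := by
  induction k with
  | zero => rw [initSeg_zero, List.eq_nil_of_length_eq_zero (hl 0)]
  | succ k ih =>
    obtain ⟨ρ, hρ⟩ := hp k
    have h1 : ρ.length = 1 := by
      have := congrArg List.length hρ
      simp [hl] at this
      omega
    obtain ⟨v, rfl⟩ := List.length_eq_one_iff.1 h1
    rw [initSeg_succ, ih, ← hρ]
    have h2 := hl k
    simp [List.getD_eq_getElem?_getD, h2]

/-- Adjoin to each entry of `y` the least code of a plausible preimage. -/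
noncomputable def liftStr (D : List ℕ → ℕ → ℕ) (c : Code) (n : ℕ) (l y : List ℕ) : List ℕ :=
  (List.range y.length).map fun m =>
    Nat.pair (y.getD m 0) (sInf {v | TruePre D c n l (y.take (m + 1)) v})

/-- Finite approximations of the points in the coherent system along `a`. -/
noncomputable def systemStr (D : List ℕ → ℕ → ℕ) (c : Code) (a : ℕ → ℕ) : ℕ → ℕ → List ℕ
  | 0, _ => []
  | k + 1, n => liftStr D c n (initSeg a n)
    ((levelMap n (a n :: systemStr D c a k (n + 1))).take (k + 1))

/-- The points in the coherent system along `a`. -/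
noncomputable def systemPt (D : List ℕ → ℕ → ℕ) (c : Code) (a : ℕ → ℕ) (n m : ℕ) : ℕ :=
  (systemStr D c a (m + 1) n).getD m 0

section
variable {D : List ℕ → ℕ → ℕ} {c : Code} {a : ℕ → ℕ}

@[simp] theorem length_liftStr (n : ℕ) (l y : List ℕ) :
    (liftStr D c n l y).length = y.length := by
  simp [liftStr]

theorem take_liftStr {n k : ℕ} {l y : List ℕ} (hk : k ≤ y.length) :
    (liftStr D c n l y).take k = liftStr D c n l (y.take k) := by
  rw [liftStr, liftStr, ← List.map_take, List.take_range, List.length_take]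
  refine List.map_congr_left fun m hm => ?_
  have hm' : m + 1 ≤ k := by
    have := List.mem_range.1 hm
    omega
  rw [List.take_take, min_eq_left hm', List.getD_eq_getElem?_getD, List.getD_eq_getElem?_getD,
    List.getElem?_take_of_lt hm']

theorem liftStr_mono {n : ℕ} {l y z : List ℕ} (h : y <+: z) :
    liftStr D c n l y <+: liftStr D c n l z := by
  have h1 := take_liftStr (D := D) (c := c) (n := n) (l := l) h.length_le
  rw [← List.prefix_iff_eq_take.1 h] at h1
  rw [← h1]
  exact List.take_prefix _ _

theorem liftStr_getD {n m : ℕ} {l y : List ℕ} (h : m < y.length) :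
    (liftStr D c n l y).getD m 0 =
      Nat.pair (y.getD m 0) (sInf {v | TruePre D c n l (y.take (m + 1)) v}) := by
  simp [liftStr, List.getD_eq_getElem?_getD, h]

theorem length_take_levelMap {n k : ℕ} {σ : List ℕ} (h : σ.length = k) :
    ((levelMap n σ).take k).length = k := by
  have := length_le_extMap (prefix_forceLim (orac n)) σ
  rw [List.length_take, min_eq_left]
  rw [levelMap]
  omega

theorem length_systemStr (k : ℕ) : ∀ n, (systemStr D c a k n).length = k := by
  induction k with
  | zero => simp [systemStr]
  | succ k ih =>
    intro n
    rw [systemStr, length_liftStr, length_take_levelMap (by simp [ih])]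

theorem systemStr_prefix (k : ℕ) : ∀ n, systemStr D c a k n <+: systemStr D c a (k + 1) n := by
  induction k with
  | zero => simp [systemStr]
  | succ k ih =>
    intro n
    have h1 : levelMap n (a n :: systemStr D c a k (n + 1)) <+:
        levelMap n (a n :: systemStr D c a (k + 1) (n + 1)) :=
      extMap_mono (prefix_forceLim _) (List.cons_prefix_cons.2 ⟨rfl, ih _⟩)
    rw [systemStr, systemStr]
    refine liftStr_mono ?_
    refine List.prefix_of_prefix_length_le ((List.take_prefix _ _).trans h1)
      (List.take_prefix _ _) ?_
    rw [length_take_levelMap (by simp [length_systemStr]),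
      length_take_levelMap (by simp [length_systemStr])]
    omega

theorem initSeg_systemPt (n k : ℕ) : initSeg (systemPt D c a n) k = systemStr D c a k n :=
  initSeg_of_chain (u := fun k => systemStr D c a k n) (fun k => length_systemStr k n)
    (fun k => systemStr_prefix k n) k

theorem systemPt_eq (n m : ℕ) : systemPt D c a n m =
    Nat.pair (levelPath n (consF (a n) (systemPt D c a (n + 1))) m)
      (sInf {v | TruePre D c n (initSeg a n)
        (initSeg (levelPath n (consF (a n) (systemPt D c a (n + 1)))) (m + 1)) v}) := by
  have h := initSeg_levelPath n (consF (a n) (systemPt D c a (n + 1))) (m + 1)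
  rw [← initSeg_getD (levelPath n _) (Nat.lt_succ_self m) 0, h, initSeg_consF, initSeg_systemPt,
    systemPt, systemStr, liftStr_getD, List.take_take, min_self]
  rw [length_take_levelMap (by simp [length_systemStr])]
  exact Nat.lt_succ_self m

theorem fstF_systemPt (n : ℕ) : fstF (systemPt D c a n) =
    levelPath n (consF (a n) (systemPt D c a (n + 1))) := by
  funext m
  rw [fstF, systemPt_eq, Nat.unpair_pair]

theorem eventually_truePre (hc : ∀ l α ρ, c.eval (Encodable.encode (l, α, ρ)) =
    Part.some (if NodeOK D c l α ρ then 1 else 0)) {n k : ℕ} {s : ℕ → ℕ}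
    (hrow : TrueRow D (initSeg a (n + 1)))
    (hs : ∀ i ≤ k, TrueNode D c (n + 1) (initSeg a (n + 1)) (initSeg s i)) :
    ∃ v, TruePre D c n (initSeg a n) (initSeg (levelPath n (consF (a n) s)) (k + 1)) v := by
  have e1 := levelMap_eventually n (a n :: initSeg s k)
  have e2 : ∀ᶠ t in atTop, ∀ i ∈ Set.Iic k, (Accepts c t (initSeg a (n + 1),
      (nextStr n (initSeg (orac n) t)).take (lastEntry (initSeg s i)), initSeg s i) ↔
      TrueNode D c (n + 1) (initSeg a (n + 1)) (initSeg s i)) :=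
    (eventually_all_finite (Set.finite_Iic k)).2 fun i _ => accepts_eventually hc n _ _
  obtain ⟨t, h1, h2, h3, h4⟩ := (e1.and (e2.and ((eventually_ge_atTop (k + 1)).and
    (eventually_ge_atTop n)))).exists
  refine ⟨Nat.pair t (Encodable.encode (a n :: initSeg s k)), ?_⟩
  simp only [TruePre, PreOK, Nat.unpair_pair, strOf_encode, initSeg_length, List.headI_cons,
    List.tail_cons, List.length_cons, ← initSeg_succ]
  refine ⟨h3, trivial, ?_, ?_, fun i hi => ?_⟩
  · rw [h1, initSeg_levelPath, initSeg_consF]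
    exact List.take_prefix _ _
  · rw [rowOK_iff (initSeg_length _ _)]
    exact ⟨h4, hrow⟩
  · rw [initSeg_take_of_le _ hi]
    exact (h2 i hi).2 (hs i hi)

theorem goodPoint_systemPt (hc : ∀ l α ρ, c.eval (Encodable.encode (l, α, ρ)) =
    Part.some (if NodeOK D c l α ρ then 1 else 0))
    (hrow : ∀ n, TrueRow D (initSeg a (n + 1))) (n : ℕ) :
    GoodPoint D c n (initSeg a n) (systemPt D c a n) := by
  suffices h : ∀ k, ∀ i ≤ k, ∀ n, TrueNode D c n (initSeg a n) (initSeg (systemPt D c a n) i) from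
    fun k => h k k le_rfl n
  intro k
  induction k with
  | zero =>
    intro i hi n
    rw [Nat.le_zero.1 hi]
    exact trueNode_zero
  | succ k ih =>
    intro i hi n
    rcases Nat.le_succ_iff.1 hi with hi | rfl
    · exact ih i hi n
    · obtain ⟨v, hv⟩ := eventually_truePre hc (hrow n) (fun i hi => ih i hi (n + 1))
      rw [trueNode_succ, fstF_systemPt, systemPt_eq, Nat.unpair_pair]
      set S := {v | TruePre D c n (initSeg a n)
        (initSeg (levelPath n (consF (a n) (systemPt D c a (n + 1)))) (k + 1)) v} with hS
      have hm : sInf S ∈ S := Nat.sInf_mem ⟨v, hv⟩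
      exact ⟨hm, fun w hw => Nat.notMem_of_lt_sInf hw⟩

theorem goodPoint_zero_iff (hc : ∀ l α ρ, c.eval (Encodable.encode (l, α, ρ)) =
    Part.some (if NodeOK D c l α ρ then 1 else 0)) {A : ℕ → ℕ}
    (hA : ∀ x, ∀ᶠ t in atTop, D (initSeg oracLim t) x = A x) {Y : ℕ → ℕ} :
    GoodPoint D c 0 [] Y ↔ Y = systemPt D c (trueRow D A) 0 := by
  have hgood := goodPoint_systemPt (a := trueRow D A) hc (trueRow_trueRow hA)
  constructor
  · intro h
    obtain ⟨b, Z, rfl, hZ⟩ := h.exists_system hc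
    obtain rfl := eq_trueRow hA fun n => (hZ n).2.2
    have := system_unique (fun n => ⟨(hZ n).1, (hZ n).2.1⟩)
      (fun n => ⟨hgood n, fstF_systemPt n⟩)
    funext k
    rw [← initSeg_getD (Z 0) (Nat.lt_succ_self k) 0, this, initSeg_getD _ (Nat.lt_succ_self k)]
  · rintro rfl
    exact hgood 0

/-- The recursive tree whose paths are the good points of level zero. -/
theorem isPi01_systemPt (hD : Primrec fun p : List ℕ × ℕ => D p.1 p.2)
    (hc : ∀ l α ρ, c.eval (Encodable.encode (l, α, ρ)) =
    Part.some (if NodeOK D c l α ρ then 1 else 0)) {A : ℕ → ℕ}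
    (hA : ∀ x, ∀ᶠ t in atTop, D (initSeg oracLim t) x = A x) :
    IsPi01 {systemPt D c (trueRow D A) 0} := by
  have h0 : ∀ k, initSeg (orac 0) k = (List.range k).map fun _ => 0 := fun k => rfl
  refine ⟨{ρ | ∀ i ≤ ρ.length, TrueNode D c 0 [] (ρ.take i)}, ?_, ?_, ?_⟩
  · intro σ τ hστ hτ i hi
    have := hτ i (hi.trans hστ.length_le)
    rwa [take_eq_of_prefix hστ hi] at this
  · have hp : Primrec fun x : ℕ => if ∀ i ≤ (strOf x).length,
        NodeOK D c [] ((List.range (lastEntry ((strOf x).take i))).map fun _ => 0)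
          ((strOf x).take i) then 1 else 0 := by fun_prop
    obtain ⟨d, hd⟩ := Code.exists_code.1 (Partrec.nat_iff.1 hp.to_comp.partrec)
    refine ⟨OCode.ofCode d, fun σ => ?_⟩
    rw [evalo_ofCode, hd]
    simp [chi, TrueNode, h0]
  · ext Y
    rw [Set.mem_singleton_iff, ← goodPoint_zero_iff hc hA]
    constructor
    · intro h n i hi
      rw [initSeg_length] at hi
      rw [initSeg_take_of_le _ hi]
      exact h i
    · intro h k
      have := h k k (by rw [initSeg_length])
      rwa [initSeg_take_of_le _ le_rfl] at this

end

/-! ### Certificates for the limits of the approximations -/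

/-- `O` agrees with the limit oracle on the first columns. -/
def Sees (n : ℕ) (O : ℕ → ℕ) : Prop := ∀ m : ℕ, m.unpair.1 ≤ n + 1 → O m = oracLim m

theorem sees_oracLim (n : ℕ) : Sees n oracLim := fun _ _ => rfl

theorem sees_orac (n : ℕ) : Sees n (orac (n + 1)) := fun _ h => orac_of_le h

theorem Sees.truncStr {n : ℕ} {O : ℕ → ℕ} (h : Sees n O) (K : ℕ) :
    truncStr n (initSeg O K) = initSeg (orac n) K := by
  rw [← truncStr_lim]
  simp only [Harrington.truncStr, initSeg_length]
  refine List.map_congr_left fun m hm => ?_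
  rw [initSeg_getD _ (List.mem_range.1 hm), initSeg_getD _ (List.mem_range.1 hm)]
  split_ifs with hmn
  · exact h m (by omega)
  · rfl

/-- The approximation at stage `t` to the level map. -/
noncomputable def stageMap (γ : List ℕ) (n t : ℕ) (σ : List ℕ) : List ℕ :=
  forceMap ((truncStr n γ).take t) σ

/-- The approximation at stage `t` to the truth of the last question forced by `σ`. -/
def StageTruth (γ : List ℕ) (n t : ℕ) (σ : List ℕ) : Prop :=
  Sm (σ.length - 1) (stageMap γ n t σ) ((truncStr n γ).take t)

/-- The approximations at the two stages `α`, `α'` differ at `σ`. -/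
def StageDiff (σ α α' : List ℕ) : Prop :=
  forceMap α σ ≠ forceMap α' σ ∨
    ¬ (Sm (σ.length - 1) (forceMap α σ) α ↔ Sm (σ.length - 1) (forceMap α' σ) α')

/-- The string `γ` certifies that the approximations at `σ` do not change after stage `t`. -/
def Cert (m : ℕ) (γ : List ℕ) (n t : ℕ) (σ : List ℕ) : Prop :=
  t ≤ γ.length ∧ γ.getD (Nat.pair (n + 1) (Nat.pair m (Nat.pair t (Encodable.encode σ)))) 1 = 0

section
variable {ι : Type*} [Primcodable ι]

@[fun_prop] theorem primrec_stageMap {g s : ι → List ℕ} {n t : ι → ℕ} (hg : Primrec g)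
    (hn : Primrec n) (ht : Primrec t) (hs : Primrec s) :
    Primrec fun x => stageMap (g x) (n x) (t x) (s x) := by
  unfold stageMap
  fun_prop

@[fun_prop] theorem primrecPred_StageTruth {g s : ι → List ℕ} {n t : ι → ℕ} (hg : Primrec g)
    (hn : Primrec n) (ht : Primrec t) (hs : Primrec s) :
    PrimrecPred fun x => StageTruth (g x) (n x) (t x) (s x) := by
  unfold StageTruth
  fun_prop

@[fun_prop] theorem primrecPred_StageDiff {s a b : ι → List ℕ} (hs : Primrec s)
    (ha : Primrec a) (hb : Primrec b) : PrimrecPred fun x => StageDiff (s x) (a x) (b x) := by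
  unfold StageDiff
  simp only [ne_eq]
  fun_prop

@[fun_prop] theorem primrecPred_Cert {g s : ι → List ℕ} {m n t : ι → ℕ} (hm : Primrec m)
    (hg : Primrec g) (hn : Primrec n) (ht : Primrec t) (hs : Primrec s) :
    PrimrecPred fun x => Cert (m x) (g x) (n x) (t x) (s x) := by
  unfold Cert
  fun_prop

end

/-- `m` is an index of the question whether the approximations change after a given stage. -/
def IsCertIndex (m : ℕ) : Prop := ∀ t σ O, J2 (Nat.pair m (Nat.pair t (Encodable.encode σ))) O O ↔
  ∃ K, t ≤ K ∧ StageDiff σ (initSeg O K) (initSeg O t)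

theorem exists_isCertIndex : ∃ m, IsCertIndex m := by
  obtain ⟨m, hm⟩ := exists_universal_index (M := fun y _ α => y.unpair.1 ≤ α.length ∧
    StageDiff (strOf y.unpair.2) α (α.take y.unpair.1)) (by fun_prop)
  refine ⟨m, fun t σ O => ?_⟩
  rw [hm]
  simp only [Nat.unpair_pair, strOf_encode, initSeg_length]
  refine exists_congr fun K => and_congr_right fun hK => ?_
  rw [initSeg_take_of_le _ hK]

theorem stageTruth_eventually (n : ℕ) (σ : List ℕ) : ∀ᶠ t in atTop,
    (Sm (σ.length - 1) (forceMap (initSeg (orac n) t) σ) (initSeg (orac n) t) ↔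
      ∃ T, Sm (σ.length - 1) (levelMap n σ) (initSeg (orac n) T)) := by
  by_cases h : ∃ T, Sm (σ.length - 1) (levelMap n σ) (initSeg (orac n) T)
  · obtain ⟨T, hT⟩ := id h
    filter_upwards [levelMap_eventually n σ, eventually_ge_atTop T] with t h1 h2
    rw [h1]
    exact iff_of_true (hT.mono List.prefix_rfl (initSeg_prefix _ h2)) h
  · filter_upwards [levelMap_eventually n σ] with t h1
    rw [h1]
    exact iff_of_false (fun hS => h ⟨t, hS⟩) h

theorem Cert.sound {m n t K : ℕ} {σ : List ℕ} {O : ℕ → ℕ} (hm : IsCertIndex m) (hO : Sees n O)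
    (h : Cert m (initSeg O K) n t σ) : stageMap (initSeg O K) n t σ = levelMap n σ ∧
      (StageTruth (initSeg O K) n t σ ↔
        ∃ T, Sm (σ.length - 1) (levelMap n σ) (initSeg (orac n) T)) := by
  obtain ⟨h1, h2⟩ := h
  rw [initSeg_length] at h1
  set q := Nat.pair m (Nat.pair t (Encodable.encode σ)) with hq
  have h3 : Nat.pair (n + 1) q < K := by
    by_contra hlt
    rw [List.getD_eq_default _ _ (by rw [initSeg_length]; omega)] at h2
    exact one_ne_zero h2
  rw [initSeg_getD _ h3, hO _ (by simp), oracLim_column] at h2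
  have h4 : ¬ J2 q (orac n) (orac n) := fun hJ => by simp [hJ] at h2
  rw [hm, not_exists] at h4
  obtain ⟨s, e1, e2, e3⟩ := ((levelMap_eventually n σ).and
    ((stageTruth_eventually n σ).and (eventually_ge_atTop t))).exists
  have h5 := not_and.1 (h4 s) e3
  rw [StageDiff, not_or, not_not, not_not, e1] at h5
  rw [StageTruth, stageMap, hO.truncStr, initSeg_take_of_le _ h1]
  refine ⟨h5.1.symm, ?_⟩
  rw [← h5.2, ← e2, e1]

theorem Cert.eventually {m : ℕ} (hm : IsCertIndex m) {n : ℕ} {O : ℕ → ℕ} (hO : Sees n O)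
    (σ : List ℕ) : ∃ t, ∀ᶠ K in atTop, Cert m (initSeg O K) n t σ := by
  obtain ⟨t, ht⟩ := eventually_atTop.1 ((levelMap_eventually n σ).and (stageTruth_eventually n σ))
  refine ⟨t, ?_⟩
  set q := Nat.pair m (Nat.pair t (Encodable.encode σ)) with hq
  filter_upwards [eventually_ge_atTop t, eventually_gt_atTop (Nat.pair (n + 1) q)] with K h1 h2
  refine ⟨by rwa [initSeg_length], ?_⟩
  rw [initSeg_getD _ h2, hO _ (by simp), oracLim_column, if_neg]
  rw [hm]
  rintro ⟨s, hs, hd⟩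
  obtain ⟨a1, a2⟩ := ht s hs
  obtain ⟨b1, b2⟩ := ht t le_rfl
  rcases hd with hd | hd
  · exact hd (a1.trans b1.symm)
  · exact hd (a2.trans b2.symm)

/-! ### Verified strings -/

/-- All initial segments of `ρ` satisfy the conditions with oracle string `α`. -/
def NodesOK (D : List ℕ → ℕ → ℕ) (c : Code) (l α ρ : List ℕ) : Prop :=
  ∀ i ≤ ρ.length, lastEntry (ρ.take i) ≤ α.length ∧
    NodeOK D c l (α.take (lastEntry (ρ.take i))) (ρ.take i)

@[fun_prop] theorem primrecPred_NodesOK {ι : Type*} [Primcodable ι] {D : List ℕ → ℕ → ℕ}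
    (hD : Primrec fun p : List ℕ × ℕ => D p.1 p.2) {c : ι → Code} {l a r : ι → List ℕ}
    (hc : Primrec c) (hl : Primrec l) (ha : Primrec a) (hr : Primrec r) :
    PrimrecPred fun x => NodesOK D (c x) (l x) (a x) (r x) := by
  unfold NodesOK
  fun_prop

section
variable {D : List ℕ → ℕ → ℕ} {c : Code} {n : ℕ} {l : List ℕ} {Z : ℕ → ℕ}

theorem initSeg_getD_self (ρ : List ℕ) {i : ℕ} (hi : i ≤ ρ.length) :
    initSeg (fun m => ρ.getD m 0) i = ρ.take i := by
  apply List.ext_getElem?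
  intro j
  by_cases hj : j < i
  · rw [initSeg_getElem? _ hj, List.getElem?_take_of_lt hj,
      List.getElem?_eq_getElem (by omega), List.getD_eq_getElem _ _ (by omega)]
  · rw [List.getElem?_eq_none (by rw [initSeg_length]; omega),
      List.getElem?_eq_none (by rw [List.length_take]; omega)]

theorem NodesOK.isInit {K : ℕ} {ρ : List ℕ} (h : NodesOK D c l (initSeg (orac n) K) ρ)
    (hZ : GoodPoint D c n l Z) (hy : IsInit (fstStr ρ) (fstF Z)) : IsInit ρ Z := by
  set R : ℕ → ℕ := fun m => ρ.getD m 0 with hR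
  have hR' : initSeg R ρ.length = ρ := by rw [initSeg_getD_self ρ le_rfl, List.take_length]
  have hT : ∀ i ≤ ρ.length, TrueNode D c n l (initSeg R i) := by
    intro i hi
    obtain ⟨h1, h2⟩ := h i hi
    rw [initSeg_length] at h1
    rw [initSeg_take_of_le _ h1, ← initSeg_getD_self ρ hi] at h2
    exact h2
  have hfst : ∀ i < ρ.length, fstF R i = fstF Z i := by
    intro i hi
    rw [← hR', fstStr_initSeg] at hy
    rw [← hy.getD (by rwa [initSeg_length]) 0, initSeg_getD _ hi]
  have key : ∀ i ≤ ρ.length, initSeg R i = initSeg Z i := by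
    intro i hi
    refine initSeg_congr fun j hj => ?_
    have hj' : j < ρ.length := lt_of_lt_of_le hj hi
    obtain ⟨p1, p2⟩ := trueNode_succ.1 (hT (j + 1) hj')
    obtain ⟨q1, q2⟩ := trueNode_succ.1 (hZ (j + 1))
    rw [initSeg_congr (Y := fstF Z) fun i hi => hfst i (by omega)] at p1 p2
    have h3 : (R j).unpair.2 = (Z j).unpair.2 := by
      rcases lt_trichotomy (R j).unpair.2 (Z j).unpair.2 with hlt | heq | hlt
      · exact absurd p1 (q2 _ hlt)
      · exact heq
      · exact absurd q1 (p2 _ hlt)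
    rw [← Nat.pair_unpair (R j), ← Nat.pair_unpair (Z j), h3]
    congr 1
    exact hfst j hj'
  rw [IsInit, ← key _ le_rfl, hR']

theorem NodesOK.eventually (hZ : GoodPoint D c n l Z) (k : ℕ) :
    ∀ᶠ K in atTop, NodesOK D c l (initSeg (orac n) K) (initSeg Z k) := by
  have h : ∀ᶠ K in atTop, ∀ i ∈ Set.Iic k, lastEntry (initSeg Z i) ≤ K :=
    (eventually_all_finite (Set.finite_Iic k)).2 fun i _ => eventually_ge_atTop _
  filter_upwards [h] with K hK i hi
  rw [initSeg_length] at hi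
  rw [initSeg_take_of_le _ hi, initSeg_length, initSeg_take_of_le _ (hK i hi)]
  exact ⟨hK i hi, hZ i⟩

end

/-- A coherent system of good points along `a`. -/
structure CoherentSystem (D : List ℕ → ℕ → ℕ) (c : Code) (a : ℕ → ℕ) (Z : ℕ → ℕ → ℕ) : Prop where
  good : ∀ n, GoodPoint D c n (initSeg a n) (Z n)
  fst_eq : ∀ n, fstF (Z n) = levelPath n (consF (a n) (Z (n + 1)))

theorem isInit_cons_consF {i b : ℕ} {s : ℕ → ℕ} {σ : List ℕ} :
    IsInit (i :: σ) (consF b s) ↔ i = b ∧ IsInit σ s := by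
  rw [IsInit, List.length_cons, initSeg_consF, List.cons.injEq]
  rfl

/-- Search for the value at `e` of the next jump, using an index `i` for the current one. -/
def JumpSearch (D : List ℕ → ℕ → ℕ) (c : Code) (m j i : ℕ) (l : List ℕ) (e v : ℕ)
    (τ α : List ℕ) : Prop :=
  ∃ k < α.length, ∃ t ≤ α.length, (strOf k).length = Nat.pair j (Nat.pair i e) ∧
    NodesOK D c l α (strOf k) ∧ fstStr (strOf k) <+: τ ∧
    Cert m α (l.length - 1) t (lastEntry l :: strOf k) ∧
    ((v = 1 ∧ StageTruth α (l.length - 1) t (lastEntry l :: strOf k)) ∨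
      (v = 0 ∧ ¬ StageTruth α (l.length - 1) t (lastEntry l :: strOf k)))

section
variable {D : List ℕ → ℕ → ℕ} {c : Code} {a : ℕ → ℕ} {Z : ℕ → ℕ → ℕ}

@[fun_prop] theorem primrecPred_JumpSearch {ι : Type*} [Primcodable ι]
    (hD : Primrec fun p : List ℕ × ℕ => D p.1 p.2) {m j i e v : ι → ℕ} {l t b : ι → List ℕ}
    (hm : Primrec m) (hj : Primrec j) (hi : Primrec i) (hl : Primrec l) (he : Primrec e)
    (hv : Primrec v) (ht : Primrec t) (hb : Primrec b) :
    PrimrecPred fun x => JumpSearch D c (m x) (j x) (i x) (l x) (e x) (v x) (t x) (b x) := by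
  unfold JumpSearch
  fun_prop

theorem jump_eq_zero_or_one (f : ℕ → ℕ) (e : ℕ) : jump f e = 0 ∨ jump f e = 1 := by
  rw [jump]
  split_ifs <;> simp

theorem CoherentSystem.jumpSearch_iff (hS : CoherentSystem D c a Z) {m j i n e v : ℕ}
    (hm : IsCertIndex m) (hj : ∀ p e f Y O, GRi p f Y O →
      (J2 (Nat.pair j (Nat.pair p e)) Y O ↔ jump f e = 1)) {f : ℕ → ℕ}
    (hf : GRi i f (fstF (Z n)) (orac n)) : jump f e = v ↔
      ∃ K, JumpSearch D c m j i (initSeg a (n + 1)) e v (initSeg (fstF (Z (n + 1))) K)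
        (initSeg (orac (n + 1)) K) := by
  set q := Nat.pair j (Nat.pair i e) with hq
  have hjump : jump f e = 1 ↔
      ∃ T, Sm q (levelMap n (a n :: initSeg (Z (n + 1)) q)) (initSeg (orac n) T) := by
    rw [← hj i e f _ _ hf, hS.fst_eq, levelPath, j2_extPath_iff, initSeg_consF]
    rfl
  have hval : ∀ {K t : ℕ}, Cert m (initSeg (orac (n + 1)) K) n t
      (a n :: initSeg (Z (n + 1)) q) →
      (StageTruth (initSeg (orac (n + 1)) K) n t (a n :: initSeg (Z (n + 1)) q) ↔
        jump f e = 1) := by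
    intro K t h
    have := (h.sound hm (sees_orac n)).2
    rw [List.length_cons, initSeg_length, Nat.add_sub_cancel] at this
    rw [this, hjump]
  simp only [JumpSearch, initSeg_length, Nat.add_sub_cancel, lastEntry_initSeg]
  constructor
  · rintro rfl
    obtain ⟨t, ht⟩ := Cert.eventually hm (sees_orac n) (a n :: initSeg (Z (n + 1)) q)
    obtain ⟨K, h1, h2, h3, h4⟩ := (ht.and ((NodesOK.eventually (hS.good (n + 1)) q).and
      ((eventually_gt_atTop (Encodable.encode (initSeg (Z (n + 1)) q))).and
        (eventually_ge_atTop q)))).exists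
    have h5 := h1.1
    rw [initSeg_length] at h5
    refine ⟨K, Encodable.encode (initSeg (Z (n + 1)) q), h3, t, h5, ?_⟩
    rw [strOf_encode, fstStr_initSeg, hval h1]
    refine ⟨initSeg_length _ _, h2, initSeg_prefix _ h4, h1, ?_⟩
    rcases jump_eq_zero_or_one f e with h | h <;> simp [h]
  · rintro ⟨K, k, -, t, -, h1, h2, h3, h4, h5⟩
    have h6 := h2.isInit (hS.good (n + 1)) ((isInit_initSeg _ _).of_prefix h3)
    rw [IsInit, h1] at h6
    rw [h6] at h4 h5
    rw [hval h4] at h5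
    rcases h5 with ⟨rfl, h5⟩ | ⟨rfl, h5⟩
    · exact h5
    · exact (jump_eq_zero_or_one f e).resolve_right h5

/-- The index of the `l.length`-th jump. -/
def jumpIndex (g i : ℕ) (l : List ℕ) : ℕ :=
  (List.range l.length).foldl
    (fun p k => Nat.pair g (Nat.pair p (Encodable.encode (l.take (k + 1))))) i

@[fun_prop] theorem primrec_jumpIndex {ι : Type*} [Primcodable ι] {g i : ι → ℕ}
    {l : ι → List ℕ} (hg : Primrec g) (hi : Primrec i) (hl : Primrec l) :
    Primrec fun x => jumpIndex (g x) (i x) (l x) := by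
  unfold jumpIndex
  fun_prop

theorem jumpIndex_succ (g i n : ℕ) (a : ℕ → ℕ) : jumpIndex g i (initSeg a (n + 1)) =
    Nat.pair g (Nat.pair (jumpIndex g i (initSeg a n))
      (Encodable.encode (initSeg a (n + 1)))) := by
  have h : ∀ k ≤ n + 1, jumpIndex g i (initSeg a k) = (List.range k).foldl
      (fun p k => Nat.pair g (Nat.pair p (Encodable.encode (initSeg a (k + 1))))) i := by
    intro k _
    rw [jumpIndex, initSeg_length]
    refine List.foldl_ext _ _ _ fun p j hj => ?_
    rw [initSeg_take_of_le _ (List.mem_range.1 hj)]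
  rw [h _ le_rfl, h n (by omega), List.range_succ, List.foldl_append]
  rfl

theorem CoherentSystem.exists_base (hS : CoherentSystem D c a Z)
    (hD : Primrec fun p : List ℕ × ℕ => D p.1 p.2) : GR (Z 0) (fstF (Z 0)) (orac 0) := by
  refine GR.of_search (M := fun x v τ α => ∃ k < α.length, (strOf k).length = x + 1 ∧
    NodesOK D c [] α (strOf k) ∧ fstStr (strOf k) <+: τ ∧ lastEntry (strOf k) = v)
    (by fun_prop) fun x v => ?_
  have h0 := hS.good 0
  rw [initSeg_zero] at h0
  constructor
  · rintro rfl
    obtain ⟨K, h1, h2, h3⟩ := ((NodesOK.eventually h0 (x + 1)).and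
      ((eventually_gt_atTop (Encodable.encode (initSeg (Z 0) (x + 1)))).and
        (eventually_ge_atTop (x + 1)))).exists
    refine ⟨K, Encodable.encode (initSeg (Z 0) (x + 1)), by rwa [initSeg_length], ?_⟩
    rw [strOf_encode, fstStr_initSeg]
    exact ⟨initSeg_length _ _, h1, initSeg_prefix _ h3, lastEntry_initSeg _ _⟩
  · rintro ⟨K, k, -, h1, h2, h3, h4⟩
    have h6 := h2.isInit h0 ((isInit_initSeg _ _).of_prefix h3)
    rw [IsInit, h1] at h6
    rw [← h4, h6, lastEntry_initSeg]

theorem CoherentSystem.exists_jumpIndex (hS : CoherentSystem D c a Z)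
    (hD : Primrec fun p : List ℕ × ℕ => D p.1 p.2) :
    ∃ g i, ∀ n, GRi (jumpIndex g i (initSeg a n)) (jumpIter (Z 0) n) (fstF (Z n)) (orac n) := by
  obtain ⟨m, hm⟩ := exists_isCertIndex
  obtain ⟨j, hj⟩ := exists_jump_index
  obtain ⟨i, hi⟩ := hS.exists_base hD
  obtain ⟨g, hg⟩ := exists_universal_index (M := fun y τ α => JumpSearch D c m j
    y.unpair.1.unpair.1 (strOf y.unpair.1.unpair.2) y.unpair.2.unpair.1 y.unpair.2.unpair.2 τ α)
    (by fun_prop)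
  refine ⟨g, i, fun n => ?_⟩
  induction n with
  | zero => exact hi
  | succ n ih =>
    intro e v
    rw [jumpIndex_succ, ask_pair, hg, jumpIter, hS.jumpSearch_iff hm hj ih]
    simp only [Nat.unpair_pair, strOf_encode]

/-! ### Chains of certified strings -/

/-- `L` is a certified chain of strings through the levels from `n` on, along the string `l`. -/
def IsChain (D : List ℕ → ℕ → ℕ) (c : Code) (m n : ℕ) (l γ : List ℕ) (L : List (List ℕ)) : Prop :=
  L.getD (L.length - 1) [] = [] ∧ ∀ j < L.length - 1, ∃ t ≤ γ.length,
    Cert m γ (n + j) t (l.getD (n + j) 0 :: L.getD (j + 1) []) ∧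
    fstStr (L.getD j []) = stageMap γ (n + j) t (l.getD (n + j) 0 :: L.getD (j + 1) []) ∧
    NodesOK D c (l.take (n + j)) (truncStr (n + j) γ) (L.getD j [])

@[fun_prop] theorem primrecPred_IsChain {ι : Type*} [Primcodable ι]
    (hD : Primrec fun p : List ℕ × ℕ => D p.1 p.2) {m n : ι → ℕ} {l b : ι → List ℕ}
    {L : ι → List (List ℕ)} (hm : Primrec m) (hn : Primrec n) (hl : Primrec l) (hb : Primrec b)
    (hL : Primrec L) :
    PrimrecPred fun x => IsChain D c (m x) (n x) (l x) (b x) (L x) := by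
  unfold IsChain
  fun_prop

theorem IsChain.isInit (hS : CoherentSystem D c a Z) {m n K : ℕ} {l : List ℕ}
    {L : List (List ℕ)} (hm : IsCertIndex m) (h : IsChain D c m n l (initSeg oracLim K) L)
    (hl : IsInit l a) (hL : n + L.length ≤ l.length + 1) :
    IsInit (L.getD 0 []) (Z n) := by
  suffices key : ∀ d j, j + d = L.length - 1 → IsInit (L.getD j []) (Z (n + j)) from
    key (L.length - 1) 0 (by omega)
  intro d
  induction d with
  | zero =>
    intro j hj
    rw [show j = L.length - 1 by omega, h.1]
    simp [IsInit]
  | succ d ih =>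
    intro j hj
    have h1 := ih (j + 1) (by omega)
    obtain ⟨t, -, h2, h3, h4⟩ := h.2 j (by omega)
    rw [(h2.sound hm (sees_oracLim _)).1, hl.getD (by omega)] at h3
    rw [truncStr_lim] at h4
    have h5 : l.take (n + j) = initSeg a (n + j) := by
      rw [hl, initSeg_take_of_le _ (by omega)]
    rw [h5] at h4
    refine h4.isInit (hS.good _) ?_
    rw [h3, hS.fst_eq]
    exact isInit_extMap_of_isInit (prefix_forceLim _) (isInit_cons_consF.2 ⟨rfl, h1⟩)

theorem IsChain.getD_eq (hS : CoherentSystem D c a Z) {m K : ℕ} {l : List ℕ}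
    {L : List (List ℕ)} (hm : IsCertIndex m) (h : IsChain D c m 0 l (initSeg oracLim K) L)
    (h0 : IsInit (L.getD 0 []) (Z 0)) {j : ℕ} (hj : j < L.length - 1) : l.getD j 0 = a j := by
  have step : ∀ j < L.length - 1, IsInit (L.getD j []) (Z j) →
      l.getD j 0 = a j ∧ IsInit (L.getD (j + 1) []) (Z (j + 1)) := by
    intro j hj hi
    obtain ⟨t, -, h2, h3, -⟩ := h.2 j hj
    rw [zero_add] at h2 h3
    rw [(h2.sound hm (sees_oracLim _)).1] at h3
    have h4 : IsInit (fstStr (L.getD j [])) (fstF (Z j)) := by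
      rw [hi, fstStr_initSeg]
      exact isInit_initSeg _ _
    rw [h3, hS.fst_eq] at h4
    exact isInit_cons_consF.1 (isInit_of_extMap (prefix_forceLim _) h4)
  have key : ∀ j ≤ L.length - 1, IsInit (L.getD j []) (Z j) := by
    intro j
    induction j with
    | zero => exact fun _ => h0
    | succ j ih => exact fun hj => (step j hj (ih (by omega))).2
  exact (step j hj (key j hj.le)).1

/-- Initial segments of the points in a coherent system which form a chain. -/
noncomputable def chainStr (a : ℕ → ℕ) (Z : ℕ → ℕ → ℕ) : ℕ → ℕ → List ℕ
  | 0, _ => []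
  | k + 1, n => initSeg (Z n) (levelMap n (a n :: chainStr a Z k (n + 1))).length

theorem isInit_chainStr (k n : ℕ) : IsInit (chainStr a Z k n) (Z n) := by
  cases k with
  | zero => simp [chainStr, IsInit]
  | succ k => exact isInit_initSeg _ _

theorem CoherentSystem.fstStr_chainStr (hS : CoherentSystem D c a Z) (k n : ℕ) :
    fstStr (chainStr a Z (k + 1) n) = levelMap n (a n :: chainStr a Z k (n + 1)) := by
  rw [chainStr, fstStr_initSeg, hS.fst_eq]
  exact (isInit_extMap_of_isInit (prefix_forceLim _)
    (isInit_cons_consF.2 ⟨rfl, isInit_chainStr k (n + 1)⟩)).symm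

theorem le_length_chainStr (k : ℕ) : ∀ n, k ≤ (chainStr a Z k n).length := by
  induction k with
  | zero => simp
  | succ k ih =>
    intro n
    have := length_le_extMap (prefix_forceLim (orac n)) (a n :: chainStr a Z k (n + 1))
    rw [List.length_cons] at this
    rw [chainStr, initSeg_length, levelMap]
    exact (Nat.succ_le_succ (ih _)).trans this

/-- The chain with `k + 1` members from level `n` on. -/
noncomputable def chainList (a : ℕ → ℕ) (Z : ℕ → ℕ → ℕ) (n k : ℕ) : List (List ℕ) :=
  (List.range (k + 1)).map fun j => chainStr a Z (k - j) (n + j)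

@[simp] theorem length_chainList (n k : ℕ) : (chainList a Z n k).length = k + 1 := by
  simp [chainList]

theorem chainList_getD {n k j : ℕ} (h : j ≤ k) :
    (chainList a Z n k).getD j [] = chainStr a Z (k - j) (n + j) := by
  simp [chainList, List.getD_eq_getElem?_getD, Nat.lt_succ_of_le h]

theorem CoherentSystem.isChain_eventually (hS : CoherentSystem D c a Z) {m : ℕ}
    (hm : IsCertIndex m) (n k : ℕ) : ∀ᶠ K in atTop, ∀ l, IsInit l a → n + k ≤ l.length →
      IsChain D c m n l (initSeg oracLim K) (chainList a Z n k) := by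
  have h : ∀ᶠ K in atTop, ∀ j ∈ Set.Iio k, ∃ t,
      Cert m (initSeg oracLim K) (n + j) t (a (n + j) :: chainStr a Z (k - (j + 1)) (n + (j + 1))) ∧
      NodesOK D c (initSeg a (n + j)) (truncStr (n + j) (initSeg oracLim K))
        (chainStr a Z (k - j) (n + j)) := by
    refine (eventually_all_finite (Set.finite_Iio k)).2 fun j _ => ?_
    obtain ⟨t, ht⟩ := Cert.eventually hm (sees_oracLim (n + j))
      (a (n + j) :: chainStr a Z (k - (j + 1)) (n + (j + 1)))
    filter_upwards [ht, NodesOK.eventually (hS.good (n + j)) (chainStr a Z (k - j) (n + j)).length]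
      with K h1 h2
    refine ⟨t, h1, ?_⟩
    rw [truncStr_lim, isInit_chainStr (k - j) (n + j)]
    exact h2
  filter_upwards [h] with K hK l hl hlk
  rw [IsChain, length_chainList, Nat.add_sub_cancel]
  refine ⟨by rw [chainList_getD le_rfl, Nat.sub_self, chainStr], fun j hj => ?_⟩
  obtain ⟨t, h1, h2⟩ := hK j hj
  have h3 : l.take (n + j) = initSeg a (n + j) := by
    rw [hl, initSeg_take_of_le _ (by omega)]
  rw [hl.getD (by omega), chainList_getD hj.le, chainList_getD (Nat.succ_le_of_lt hj), h3]
  refine ⟨t, h1.1, h1, ?_, h2⟩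
  rw [(h1.sound hm (sees_oracLim _)).1, show k - j = k - (j + 1) + 1 by omega,
    hS.fstStr_chainStr]
  rfl

theorem CoherentSystem.gr_row (hS : CoherentSystem D c a Z)
    (hD : Primrec fun p : List ℕ × ℕ => D p.1 p.2) : GR a (Z 0) oracLim := by
  obtain ⟨m, hm⟩ := exists_isCertIndex
  refine GR.of_search (M := fun x v τ γ => ∃ k < γ.length, ∃ i < γ.length,
    (Denumerable.ofNat (List (List ℕ)) i).length = x + 2 ∧ (strOf k).getD x 0 = v ∧
    IsChain D c m 0 (strOf k) γ (Denumerable.ofNat (List (List ℕ)) i) ∧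
    (Denumerable.ofNat (List (List ℕ)) i).getD 0 [] <+: τ) (by fun_prop) fun x v => ?_
  constructor
  · rintro rfl
    obtain ⟨K, h1, h2, h3, h4⟩ := ((hS.isChain_eventually hm 0 (x + 1)).and
      ((eventually_gt_atTop (Encodable.encode (initSeg a (x + 1)))).and
      ((eventually_gt_atTop (Encodable.encode (chainList a Z 0 (x + 1)))).and
      (eventually_ge_atTop (chainStr a Z (x + 1) 0).length)))).exists
    refine ⟨K, Encodable.encode (initSeg a (x + 1)), by rwa [initSeg_length],
      Encodable.encode (chainList a Z 0 (x + 1)), by rwa [initSeg_length], ?_⟩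
    rw [Denumerable.ofNat_encode, strOf_encode, chainList_getD (Nat.zero_le _)]
    refine ⟨length_chainList _ _, initSeg_getD _ (Nat.lt_succ_self x) _,
      h1 _ (isInit_initSeg _ _) (by rw [initSeg_length]; omega), ?_⟩
    exact (isInit_iff_prefix h4).1 (isInit_chainStr _ _)
  · rintro ⟨K, k, -, i, -, h1, h2, h3, h4⟩
    rw [← h2]
    exact (h3.getD_eq hS hm ((isInit_initSeg _ _).of_prefix h4) (by omega)).symm

theorem CoherentSystem.gr_omegaJump (hS : CoherentSystem D c a Z)
    (hD : Primrec fun p : List ℕ × ℕ => D p.1 p.2) : GR (omegaJump (Z 0)) a oracLim := by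
  obtain ⟨m, hm⟩ := exists_isCertIndex
  obtain ⟨g, p, hp⟩ := hS.exists_jumpIndex hD
  refine GR.of_search (M := fun z v τ γ => ∃ u < γ.length, ∃ i < γ.length,
    v = (if u = 0 then 0 else 1) ∧
    z.unpair.2 + (Denumerable.ofNat (List (List ℕ)) i).length ≤ τ.length + 1 ∧
    IsChain D c m z.unpair.2 τ γ (Denumerable.ofNat (List (List ℕ)) i) ∧
    Sm (ask (jumpIndex g p (τ.take z.unpair.2)) (Nat.pair z.unpair.1 u))
      (fstStr ((Denumerable.ofNat (List (List ℕ)) i).getD 0 [])) (truncStr z.unpair.2 γ) ∧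
    z.unpair.2 ≤ τ.length)
    (by fun_prop) fun z v => ?_
  set n := z.unpair.2 with hn
  set e := z.unpair.1 with he
  constructor
  · intro hv
    obtain ⟨T, hT⟩ := (hp n e (jumpIter (Z 0) n e)).1 rfl
    obtain ⟨K, h1, h2, h3, h4⟩ := ((hS.isChain_eventually hm n T).and
      ((eventually_gt_atTop (jumpIter (Z 0) n e)).and
      ((eventually_gt_atTop (Encodable.encode (chainList a Z n T))).and
      (eventually_ge_atTop (n + T))))).exists
    refine ⟨K, jumpIter (Z 0) n e, by rwa [initSeg_length],
      Encodable.encode (chainList a Z n T), by rwa [initSeg_length], ?_⟩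
    rw [Denumerable.ofNat_encode, chainList_getD (Nat.zero_le _), length_chainList,
      initSeg_length, initSeg_take_of_le _ (by omega), truncStr_lim]
    refine ⟨?_, by omega, h1 _ (isInit_initSeg _ _) (by rw [initSeg_length]; omega), ?_, by omega⟩
    · rw [← hv, omegaJump, ← hn, ← he]
      simp only [ne_eq, ite_not]
    · refine hT.mono ?_ (initSeg_prefix _ (by omega))
      have h5 : IsInit (chainStr a Z T n) (Z n) := isInit_chainStr T n
      rw [Nat.sub_zero, Nat.add_zero, h5, fstStr_initSeg]
      exact initSeg_prefix _ (le_length_chainStr T n)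
  · rintro ⟨K, u, -, i, -, h1, h2, h3, h4, h5⟩
    rw [initSeg_length] at h5
    have h6 := h3.isInit hS hm (isInit_initSeg _ _) h2
    rw [initSeg_take_of_le _ h5, truncStr_lim] at h4
    have h7 : jumpIter (Z 0) n e = u := by
      refine (hp n e u).2 (h4.j2 ?_ (isInit_initSeg _ _))
      rw [h6, fstStr_initSeg]
      exact isInit_initSeg _ _
    rw [h1, omegaJump, ← hn, ← he, h7]
    simp only [ne_eq, ite_not]

end

/-! ### The row and the set it codes -/

section
variable {D : List ℕ → ℕ → ℕ} {A : ℕ → ℕ}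

theorem gr_trueRow_fst (O : ℕ → ℕ) : GR A (trueRow D A) O := by
  refine GR.of_search (M := fun x v τ _ => x < τ.length ∧ (τ.getD x 0).unpair.1 = v)
    (by fun_prop) fun x v => ?_
  constructor
  · rintro rfl
    refine ⟨x + 1, by rw [initSeg_length]; omega, ?_⟩
    rw [initSeg_getD _ (Nat.lt_succ_self x), trueRow, Nat.unpair_pair]
  · rintro ⟨K, h1, h2⟩
    rw [initSeg_length] at h1
    rwa [initSeg_getD _ h1, trueRow, Nat.unpair_pair] at h2

theorem gr_trueRow (hD : Primrec fun p : List ℕ × ℕ => D p.1 p.2)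
    (hA : ∀ x, ∀ᶠ t in atTop, D (initSeg oracLim t) x = A x) : GR (trueRow D A) A oracLim := by
  refine GR.of_search (M := fun x v τ γ => x < τ.length ∧ τ.getD x 0 = v.unpair.1 ∧
    v.unpair.2 ≤ γ.length ∧ x ≤ v.unpair.2 ∧
    (∀ i ≤ x, D (γ.take v.unpair.2) i = τ.getD i 0) ∧
    ∀ s < v.unpair.2, s < x ∨ ¬ ∀ i ≤ x, D (γ.take s) i = τ.getD i 0) (by fun_prop) fun x v => ?_
  constructor
  · rintro rfl
    have hle := (modulus_spec hA x).1
    have htau : ∀ i ≤ x, (initSeg A (modulus D A x + 1)).getD i 0 = A i := fun i hi =>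
      initSeg_getD _ (by omega) _
    refine ⟨modulus D A x + 1, ?_⟩
    simp only [trueRow, Nat.unpair_pair, initSeg_length]
    refine ⟨by omega, htau x le_rfl, by omega, hle, fun i hi => ?_, fun s hs => ?_⟩
    · rw [htau i hi, initSeg_take_of_le _ (by omega)]
      exact (modulus_spec hA x).2 i hi
    · rcases lt_or_ge s x with h | h
      · exact Or.inl h
      · refine Or.inr fun hall => not_of_lt_modulus h hs fun i hi => ?_
        have := hall i hi
        rwa [htau i hi, initSeg_take_of_le _ (by omega)] at this
  · rintro ⟨K, h1, h2, h3, h4, h5, h6⟩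
    rw [initSeg_length] at h1 h3
    have htau : ∀ i ≤ x, (initSeg A K).getD i 0 = A i := fun i hi => initSeg_getD _ (by omega) _
    rw [htau x le_rfl] at h2
    rw [← Nat.pair_unpair v, ← h2, trueRow]
    congr 1
    refine le_antisymm (Nat.sInf_le ⟨h4, fun i hi => ?_⟩) ?_
    · have := h5 i hi
      rwa [htau i hi, initSeg_take_of_le _ h3] at this
    · by_contra hlt
      rcases h6 _ (not_le.1 hlt) with h | h
      · have := (modulus_spec hA x).1
        omega
      · refine h fun i hi => ?_
        rw [htau i hi, initSeg_take_of_le _ (by omega)]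
        exact (modulus_spec hA x).2 i hi

/-- Every limit of guesses from the limit oracle is coded by a `Π⁰₁` singleton whose `ω`-jump
is no more complicated than the limit. -/
theorem exists_isPi01_singleton (hD : Primrec fun p : List ℕ × ℕ => D p.1 p.2)
    (hA : ∀ x, ∀ᶠ t in atTop, D (initSeg oracLim t) x = A x) :
    ∃ X, IsPi01 {X} ∧ GR A X oracLim ∧ GR (omegaJump X) A oracLim := by
  obtain ⟨c, hc⟩ := exists_self_code hD
  have hS : CoherentSystem D c (trueRow D A) (systemPt D c (trueRow D A)) :=
    ⟨goodPoint_systemPt hc (trueRow_trueRow hA), fstF_systemPt⟩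
  exact ⟨_, isPi01_systemPt hD hc hA, (gr_trueRow_fst _).trans (hS.gr_row hD),
    (hS.gr_omegaJump hD).trans (gr_trueRow hD hA)⟩

end

/-! ### Two points of mutually incomparable degree over the oracle -/

/-- One step of the Kleene–Post construction: the first string receives a diagonalizing entry,
the second one is extended if possible, and the two strings are exchanged. -/
noncomputable def kpStep (γ : List ℕ) (s : ℕ) (u : List ℕ × List ℕ) : List ℕ × List ℕ :=
  (findExt (ask (s / 2) (Nat.pair u.1.length 0)) u.2 γ).elim (u.2, u.1 ++ [0])
    fun k => (u.2 ++ strOf k.unpair.1, u.1 ++ [1])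

/-- The pair of strings after `s` steps of the Kleene–Post construction. -/
noncomputable def kpStage (γ : List ℕ) (s : ℕ) : List ℕ × List ℕ :=
  Nat.rec ([], []) (kpStep γ) s

@[fun_prop] theorem primrec_kpStage {α : Type*} [Primcodable α] {f : α → List ℕ} {g : α → ℕ}
    (hf : Primrec f) (hg : Primrec g) : Primrec fun x => kpStage (f x) (g x) := by
  unfold kpStage kpStep
  fun_prop

/-- `u'` arises from `u` by a step of the Kleene–Post construction with the limit oracle. -/
def KPNext (s : ℕ) (u u' : List ℕ × List ℕ) : Prop :=
  (∃ k : ℕ, Sm (ask (s / 2) (Nat.pair u.1.length 0)) (u.2 ++ strOf k.unpair.1)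
    (initSeg oracLim k.unpair.2) ∧ u' = (u.2 ++ strOf k.unpair.1, u.1 ++ [1])) ∨
  ((∀ k : ℕ, ¬ Sm (ask (s / 2) (Nat.pair u.1.length 0)) (u.2 ++ strOf k.unpair.1)
    (initSeg oracLim k.unpair.2)) ∧ u' = (u.2, u.1 ++ [0]))

theorem exists_kpNext (s : ℕ) (u : List ℕ × List ℕ) :
    ∃ u', KPNext s u u' ∧ ∀ᶠ t in atTop, kpStep (initSeg oracLim t) s u = u' := by
  rcases findExt_eventually (O := oracLim) (e := ask (s / 2) (Nat.pair u.1.length 0)) (β := u.2)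
    with ⟨k, h1, h2⟩ | ⟨h1, h2⟩
  · refine ⟨_, Or.inl ⟨k, h1, rfl⟩, ?_⟩
    filter_upwards [h2] with t ht
    simp [kpStep, ht]
  · exact ⟨_, Or.inr ⟨h1, rfl⟩, Eventually.of_forall fun t => by simp [kpStep, h2 t]⟩

theorem exists_kpLimit : ∃ L : ℕ → List ℕ × List ℕ, (∀ s, KPNext s (L s) (L (s + 1))) ∧
    ∀ s, ∀ᶠ t in atTop, kpStage (initSeg oracLim t) s = L s := by
  choose N hN hev using exists_kpNext
  refine ⟨fun s => Nat.rec ([], []) N s, fun s => hN _ _, fun s => ?_⟩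
  induction s with
  | zero => exact Eventually.of_forall fun t => rfl
  | succ s ih =>
    filter_upwards [ih, hev s (Nat.rec ([], []) N s)] with t h1 h2
    exact (congrArg (kpStep (initSeg oracLim t) s) h1).trans h2

theorem KPNext.snd_prefix {s : ℕ} {u u' : List ℕ × List ℕ} (h : KPNext s u u') :
    u.2 <+: u'.1 := by
  rcases h with ⟨k, -, rfl⟩ | ⟨-, rfl⟩
  · exact List.prefix_append _ _
  · exact List.prefix_rfl

theorem KPNext.fst_prefix {s : ℕ} {u u' : List ℕ × List ℕ} (h : KPNext s u u') :
    u.1 <+: u'.2 ∧ u.1.length < u'.2.length := by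
  rcases h with ⟨k, -, rfl⟩ | ⟨-, rfl⟩ <;> simp

theorem KPNext.not_gri {s : ℕ} {u u' : List ℕ × List ℕ} (h : KPNext s u u') {f g : ℕ → ℕ}
    (hf : IsInit u'.2 f) (hg : IsInit u'.1 g) : ¬ GRi (s / 2) f g oracLim := by
  intro hi
  have hgen : ∀ b, u'.2 = u.1 ++ [b] → f u.1.length = b := fun b hb => by
    rw [← hf.getD (by simp [hb]) 0, hb]
    simp
  rcases h with ⟨k, h1, rfl⟩ | ⟨h1, rfl⟩
  · have h2 := (hi _ _).2 (h1.j2 hg (isInit_initSeg _ _))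
    simp [hgen 1 rfl] at h2
  · obtain ⟨k, hk⟩ := exists_sm_of_j2 hg ((hi _ _).1 (hgen 0 rfl))
    exact h1 k hk

theorem isInit_of_chain {u : ℕ → List ℕ} (hp : ∀ n, u n <+: u (n + 1))
    (hl : ∀ n, (u n).length < (u (n + 1)).length) (n : ℕ) :
    IsInit (u n) fun x => (u (x + 1)).getD x 0 := by
  have hle : ∀ n, n ≤ (u n).length := fun n => by
    induction n with
    | zero => exact Nat.zero_le _
    | succ n ih => exact ih.trans_lt (hl n)
  have hmono : ∀ m n, m ≤ n → u m <+: u n := fun m n h => by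
    induction n, h using Nat.le_induction with
    | base => exact List.prefix_rfl
    | succ n _ ih => exact ih.trans (hp n)
  rw [isInit_iff_getElem?]
  intro i hi
  have hi' : i < (u (i + 1)).length := hle (i + 1)
  have h1 : (u n)[i]? = (u (i + 1))[i]? := by
    rcases le_total n (i + 1) with h | h
    · exact (getElem?_of_prefix (hmono _ _ h) hi).symm
    · exact getElem?_of_prefix (hmono _ _ h) hi'
  simp [h1, List.getD_eq_getElem?_getD, List.getElem?_eq_getElem hi']

theorem exists_incomparable_limits : ∃ (D E : List ℕ → ℕ → ℕ) (A B : ℕ → ℕ),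
    (Primrec fun p : List ℕ × ℕ => D p.1 p.2) ∧ (Primrec fun p : List ℕ × ℕ => E p.1 p.2) ∧
    (∀ x, ∀ᶠ t in atTop, D (initSeg oracLim t) x = A x) ∧
    (∀ x, ∀ᶠ t in atTop, E (initSeg oracLim t) x = B x) ∧
    ¬ GR A B oracLim ∧ ¬ GR B A oracLim := by
  obtain ⟨L, hL, hev⟩ := exists_kpLimit
  have hA := isInit_of_chain (u := fun n => (L (2 * n)).1)
    (fun n => (hL _).fst_prefix.1.trans (hL _).snd_prefix)
    (fun n => (hL _).fst_prefix.2.trans_le (hL _).snd_prefix.length_le)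
  have hB := isInit_of_chain (u := fun n => (L (2 * n)).2)
    (fun n => (hL _).snd_prefix.trans (hL _).fst_prefix.1)
    (fun n => (hL _).snd_prefix.length_le.trans_lt (hL _).fst_prefix.2)
  refine ⟨fun γ x => (kpStage γ (2 * (x + 1))).1.getD x 0,
    fun γ x => (kpStage γ (2 * (x + 1))).2.getD x 0,
    fun x => (L (2 * (x + 1))).1.getD x 0, fun x => (L (2 * (x + 1))).2.getD x 0,
    by fun_prop, by fun_prop,
    fun x => (hev (2 * (x + 1))).mono fun t ht => congrArg (fun u => u.1.getD x 0) ht,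
    fun x => (hev (2 * (x + 1))).mono fun t ht => congrArg (fun u => u.2.getD x 0) ht, ?_, ?_⟩
  · rintro ⟨i, hi⟩
    have h := (hL (2 * i)).not_gri ((hA (i + 1)).of_prefix (hL (2 * i + 1)).snd_prefix)
      ((hB (i + 1)).of_prefix (hL (2 * i + 1)).fst_prefix.1)
    rw [show 2 * i / 2 = i by omega] at h
    exact h hi
  · rintro ⟨i, hi⟩
    have h := (hL (2 * i + 1)).not_gri (hB (i + 1)) (hA (i + 1))
    rw [show (2 * i + 1) / 2 = i by omega] at h
    exact h hi

/-- There exist `Π⁰₁` singletons `X, Y` with `X ≰_T Y^{(ω)}` and `Y ≰_T X^{(ω)}`. -/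
theorem pi01_singletons_incomparable_up_to_omega_jump :
    ∃ X Y : ℕ → ℕ, IsPi01 {X} ∧ IsPi01 {Y} ∧
      ¬ TRedIn X (omegaJump Y) ∧ ¬ TRedIn Y (omegaJump X) := by
  obtain ⟨D, E, A, B, hD, hE, hA, hB, hAB, hBA⟩ := exists_incomparable_limits
  obtain ⟨X, hX, hAX, hXA⟩ := exists_isPi01_singleton hD hA
  obtain ⟨Y, hY, hBY, hYB⟩ := exists_isPi01_singleton hE hB
  exact ⟨X, Y, hX, hY, fun h => hAB (hAX.trans ((GR.of_tRedIn h _).trans hYB)),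
    fun h => hBA (hBY.trans ((GR.of_tRedIn h _).trans hXA))⟩

end Harrington
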